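/- arXiv:2601.13917 — 4 statements merged into one kernel-verified Lean document; each statement's English description precedes it below -/
import Mathlib

section
/- For every positive integer n there exists a constant J(n) such that for every field K of characteristic 0 and every finite subgroup G of GL_n(K), there exists an abelian normal subgroup H of G whose index [G : H] is at most J(n). -/
section NormedRing

variable {R : Type*} [NormedRing R] [NormedSpace ℝ R]

/-- An element of finite order all of whose powers lie uniformly within distance less than one
of the identity is trivial. -/
theorem eq_one_of_pow_eq_one_of_norm_pow_sub_one_le {c : R} {m : ℕ} (hm : 0 < m)
    (hc : c ^ m = 1) {r : ℝ} (hr : r < 1) (h : ∀ k : ℕ, ‖c ^ k - 1‖ ≤ r) : c = 1 := by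
  have key : m • (c - 1) = (c - 1) * ∑ k ∈ Finset.range m, (1 - c ^ k) := by
    rw [Finset.sum_sub_distrib, mul_sub, mul_geom_sum, hc, Finset.sum_const,
      Finset.card_range, sub_self, sub_zero, mul_smul_comm, mul_one]
  have hsum : ‖∑ k ∈ Finset.range m, (1 - c ^ k)‖ ≤ m * r := by
    refine (norm_sum_le_of_le _ fun k _ => ?_).trans_eq (b := ∑ _k ∈ Finset.range m, r) (by simp)
    rw [norm_sub_rev]
    exact h k
  have hle : (m : ℝ) * ‖c - 1‖ ≤ ‖c - 1‖ * (m * r) := by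
    calc (m : ℝ) * ‖c - 1‖ = ‖m • (c - 1)‖ := by
          rw [← Nat.cast_smul_eq_nsmul ℝ, norm_smul]; simp
      _ ≤ ‖c - 1‖ * ‖∑ k ∈ Finset.range m, (1 - c ^ k)‖ := key ▸ norm_mul_le _ _
      _ ≤ _ := by gcongr
  have hm' : (0 : ℝ) < m := by exact_mod_cast hm
  have hprod : 0 < (m : ℝ) * (1 - r) := mul_pos hm' (by linarith)
  have hzero : ‖c - 1‖ ≤ 0 := by
    by_contra! hpos
    nlinarith [mul_pos hpos hprod]
  exact sub_eq_zero.mp (norm_le_zero_iff.mp hzero)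

end NormedRing

section Unitary

open scoped commutatorElement

variable {R : Type*} [NormedRing R] [StarRing R] [CStarRing R] {G : Type*} [Group G]

theorem norm_unitary_conj_sub_one (φ : G →* unitary R) (g h : G) :
    ‖(φ (g * h * g⁻¹) : R) - 1‖ = ‖(φ h : R) - 1‖ := by
  have : (φ (g * h * g⁻¹) : R) - 1 = φ g * ((φ h : R) - 1) * φ g⁻¹ := by
    have h1 : (φ g : R) * φ g⁻¹ = 1 := by
      rw [← Submonoid.coe_mul, ← map_mul]; simp
    rw [mul_sub, sub_mul, mul_one, h1]
    simp only [map_mul, Submonoid.coe_mul]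
  rw [this, CStarRing.norm_mul_coe_unitary, CStarRing.norm_coe_unitary_mul]

theorem norm_unitary_inv_mul_sub_one (φ : G →* unitary R) (g h : G) :
    ‖(φ (g⁻¹ * h) : R) - 1‖ = ‖(φ h : R) - φ g‖ := by
  have h1 : (φ g : R) * φ g⁻¹ = 1 := by
    rw [← Submonoid.coe_mul, ← map_mul]; simp
  rw [← CStarRing.norm_coe_unitary_mul (φ g), mul_sub, mul_one, map_mul, Submonoid.coe_mul,
    ← mul_assoc, h1, one_mul]

theorem norm_unitary_commutator_sub_one_le (φ : G →* unitary R) (a b : G) :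
    ‖(φ ⁅a, b⁆ : R) - 1‖ ≤ 2 * ‖(φ a : R) - 1‖ * ‖(φ b : R) - 1‖ := by
  have h1 : ⁅a, b⁆ = (b * a) * ((b * a)⁻¹ * (a * b)) * (b * a)⁻¹ := by
    rw [commutatorElement_def]; group
  rw [h1, norm_unitary_conj_sub_one, norm_unitary_inv_mul_sub_one]
  have h2 : (φ (a * b) : R) - φ (b * a)
      = ((φ a : R) - 1) * ((φ b : R) - 1) - ((φ b : R) - 1) * ((φ a : R) - 1) := by
    simp only [map_mul, Submonoid.coe_mul]; noncomm_ring
  rw [h2]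
  linarith [norm_sub_le (((φ a : R) - 1) * ((φ b : R) - 1)) (((φ b : R) - 1) * ((φ a : R) - 1)),
    norm_mul_le ((φ a : R) - 1) ((φ b : R) - 1), norm_mul_le ((φ b : R) - 1) ((φ a : R) - 1)]

variable [NormedSpace ℝ R] [Finite G]

theorem commute_of_commute_commutator {φ : G →* unitary R} (hφ : Function.Injective φ) {a b : G}
    (hb : ‖(φ b : R) - 1‖ < 1 / 2) (hab : Commute a ⁅a, b⁆) : Commute a b := by
  rw [← commutatorElement_eq_one_iff_commute]
  set c := ⁅a, b⁆ with hc
  have hpow : ∀ k : ℕ, c ^ k * b = a ^ k * b * (a ^ k)⁻¹ := by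
    intro k
    induction k with
    | zero => simp
    | succ k ih =>
      have h1 : a * b * a⁻¹ = c * b := by rw [hc, commutatorElement_def]; group
      calc c ^ (k + 1) * b = c ^ k * (c * b) := by rw [pow_succ, mul_assoc]
        _ = a * (c ^ k * b) * a⁻¹ := by
          rw [← h1, ← mul_assoc, ← mul_assoc, ← mul_assoc, (hab.pow_right k).eq]
        _ = _ := by rw [ih, pow_succ']; group
  have hnorm : ∀ k : ℕ, ‖(φ c : R) ^ k - 1‖ ≤ 2 * ‖(φ b : R) - 1‖ := by
    intro k
    have h1 : (φ c : R) ^ k - 1 = φ (c ^ k) - 1 := by simp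
    have h2 : c ^ k = b * (b⁻¹ * (c ^ k * b)) * b⁻¹ := by group
    rw [h1, h2, norm_unitary_conj_sub_one, norm_unitary_inv_mul_sub_one, hpow]
    have := norm_unitary_conj_sub_one φ (a ^ k) b
    calc _ = ‖((φ (a ^ k * b * (a ^ k)⁻¹) : R) - 1) - (φ b - 1)‖ := by rw [sub_sub_sub_cancel_right]
      _ ≤ _ := norm_sub_le _ _
      _ = _ := by rw [this]; ring
  apply hφ
  rw [map_one]
  refine Subtype.ext (eq_one_of_pow_eq_one_of_norm_pow_sub_one_le (orderOf_pos c) ?_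
    (by linarith) hnorm)
  rw [← SubmonoidClass.coe_pow, ← map_pow, pow_orderOf_eq_one]
  simp

theorem commute_of_norm_unitary_sub_one_lt {φ : G →* unitary R} (hφ : Function.Injective φ)
    {a b : G} (ha : ‖(φ a : R) - 1‖ < 1 / 2) (hb : ‖(φ b : R) - 1‖ < 1 / 2) : Commute a b := by
  by_contra hab
  obtain ⟨d, ⟨hd, had⟩, hmin⟩ := Set.exists_min_image
    {g : G | ‖(φ g : R) - 1‖ < 1 / 2 ∧ ¬ Commute a g} (fun g => ‖(φ g : R) - 1‖)
    (Set.toFinite _) ⟨b, hb, hab⟩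
  have hpos : 0 < ‖(φ d : R) - 1‖ := by
    rw [norm_pos_iff, sub_ne_zero]
    intro h
    have : d = 1 := hφ (by rw [map_one]; exact Subtype.ext h)
    exact had (this ▸ Commute.one_right a)
  have hlt : ‖(φ ⁅a, d⁆ : R) - 1‖ < ‖(φ d : R) - 1‖ :=
    (norm_unitary_commutator_sub_one_le φ a d).trans_lt (by nlinarith)
  refine had (commute_of_commute_commutator hφ hd ?_)
  by_contra h
  exact (hmin _ ⟨hlt.trans hd, h⟩).not_gt hlt

end Unitary

/-- Jordan's theorem for finite groups of unitary elements. -/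
theorem exists_index_le_of_injective_unitary (R : Type*) [NormedRing R] [StarRing R] [CStarRing R]
    [NormedSpace ℝ R] [ProperSpace R] :
    ∃ J : ℕ, ∀ (G : Type) [Group G] [Finite G] (φ : G →* unitary R), Function.Injective φ →
      ∃ H : Subgroup G, H.Normal ∧ (∀ a b : H, a * b = b * a) ∧ H.index ≤ J := by
  obtain ⟨t, -, htfin, ht⟩ := (isCompact_closedBall (0 : R) 1).finite_cover_balls
    (e := 1 / 4) (by norm_num)
  refine ⟨t.ncard, fun G _ _ φ hφ => ?_⟩
  let s : Set G := {g | ‖(φ g : R) - 1‖ < 1 / 2}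
  have hs : ∀ g ∈ Group.conjugatesOfSet s, g ∈ s := by
    intro g hg
    obtain ⟨h, hh, hconj⟩ := Group.mem_conjugatesOfSet_iff.mp hg
    obtain ⟨x, rfl⟩ := isConj_iff.mp hconj
    exact (norm_unitary_conj_sub_one φ x h).trans_lt hh
  refine ⟨Subgroup.normalClosure s, inferInstance, ?_, ?_⟩
  · have : IsMulCommutative (Subgroup.normalClosure s) :=
      Subgroup.isMulCommutative_closure fun x hx y hy =>
        commute_of_norm_unitary_sub_one_lt hφ (hs x hx) (hs y hy)
    exact fun a b => mul_comm' a b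
  · have hcover : ∀ g : G, ∃ x : t, dist (φ g : R) x < 1 / 4 := by
      intro g
      have hg : (φ g : R) ∈ Metric.closedBall (0 : R) 1 := by
        rw [mem_closedBall_zero_iff]
        rcases subsingleton_or_nontrivial R with _ | _
        · rw [Subsingleton.elim (φ g : R) 0]; simp
        · exact (CStarRing.norm_coe_unitary _).le
      obtain ⟨x, hx, hgx⟩ := Set.mem_iUnion₂.mp (ht hg)
      exact ⟨⟨x, hx⟩, hgx⟩
    choose f hf using hcover
    have := htfin.to_subtype
    rw [Subgroup.index_eq_card, ← Nat.card_coe_set_eq]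
    refine Nat.card_le_card_of_injective
      (fun q : G ⧸ Subgroup.normalClosure s => f q.out) fun p q hpq => ?_
    rw [← p.out_eq', ← q.out_eq', QuotientGroup.eq]
    apply Subgroup.subset_normalClosure
    change ‖_‖ < _
    rw [norm_unitary_inv_mul_sub_one, ← dist_eq_norm]
    have h1 := hf p.out
    have h2 := hf q.out
    rw [show f p.out = f q.out from hpq] at h1
    linarith [dist_triangle_right (φ q.out : R) (φ p.out) (f q.out)]

open scoped ComplexOrder Matrix in
/-- A finite group of complex matrices is conjugate to a group of unitary matrices. -/
theorem exists_injective_unitaryGroup_of_injective {n : Type*} [Fintype n] [DecidableEq n]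
    {G : Type*} [Group G] [Finite G] (ρ : G →* Matrix n n ℂ) (hρ : Function.Injective ρ) :
    ∃ φ : G →* Matrix.unitaryGroup n ℂ, Function.Injective φ := by
  have := Fintype.ofFinite G
  let P : Matrix n n ℂ := ∑ g, (ρ g)ᴴ * ρ g
  have hP : P.PosDef := by
    classical
    have : P = 1 + ∑ g ∈ Finset.univ.erase (1 : G), (ρ g)ᴴ * ρ g := by
      simp only [P]
      rw [← Finset.add_sum_erase Finset.univ (fun g => (ρ g)ᴴ * ρ g) (Finset.mem_univ 1)]
      simp
    rw [this]
    exact Matrix.PosDef.one.add_posSemidef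
      (Matrix.posSemidef_sum _ fun g _ => Matrix.posSemidef_conjTranspose_mul_self _)
  have hinv : ∀ g, (ρ g)ᴴ * P * ρ g = P := by
    intro g
    simp only [P, Finset.mul_sum, Finset.sum_mul]
    refine Fintype.sum_equiv (Equiv.mulRight g) _ _ fun h => ?_
    simp [mul_assoc]
  obtain ⟨Q, hQ⟩ : ∃ Q : Matrix n n ℂ, P = Qᴴ * Q := by
    open scoped MatrixOrder Matrix.Norms.L2Operator in
    exact CStarAlgebra.nonneg_iff_eq_star_mul_self.mp hP.posSemidef.nonneg
  have hQu : IsUnit Q := by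
    have := hP.isUnit
    rw [hQ] at this
    exact isUnit_of_mul_isUnit_right this
  obtain ⟨u, rfl⟩ := hQu
  let ψ : G →* Matrix n n ℂ :=
    { toFun := fun g => u * ρ g * ↑u⁻¹
      map_one' := by simp
      map_mul' := fun g h => by simp [mul_assoc] }
  have hψ : ∀ g, ψ g ∈ Matrix.unitaryGroup n ℂ := by
    intro g
    rw [Matrix.mem_unitaryGroup_iff', Matrix.star_eq_conjTranspose]
    have h1 : (↑u⁻¹ : Matrix n n ℂ)ᴴ * (u : Matrix n n ℂ)ᴴ = 1 := by
      rw [← Matrix.conjTranspose_mul]; simp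
    calc (↑u * ρ g * ↑u⁻¹ : Matrix n n ℂ)ᴴ * (↑u * ρ g * ↑u⁻¹ : Matrix n n ℂ)
        = (↑u⁻¹ : Matrix n n ℂ)ᴴ * ((ρ g)ᴴ * ((u : Matrix n n ℂ)ᴴ * u) * ρ g) * ↑u⁻¹ := by
          simp only [Matrix.conjTranspose_mul, mul_assoc]
      _ = ((↑u⁻¹ : Matrix n n ℂ)ᴴ * (u : Matrix n n ℂ)ᴴ) * (↑u * ↑u⁻¹ : Matrix n n ℂ) := by
          rw [← hQ, hinv, hQ]; simp only [mul_assoc]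
      _ = 1 := by rw [h1]; simp
  refine ⟨ψ.codRestrict _ hψ, fun g h hgh => hρ ?_⟩
  have : u.val * ρ g * u⁻¹.val = u.val * ρ h * u⁻¹.val := congrArg Subtype.val hgh
  exact u.mul_right_inj.mp (u⁻¹.mul_left_inj.mp this)

/-- A countable field of characteristic zero embeds into the complex numbers. -/
theorem nonempty_ringHom_complex_of_countable (F : Type) [Field F] [CharZero F] [Countable F] :
    Nonempty (F →+* ℂ) := by
  let A := FractionRing (MvPolynomial ℝ F)
  let L := AlgebraicClosure A
  have hA : Cardinal.mk A = Cardinal.continuum := by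
    rw [IsFractionRing.cardinalMk (MvPolynomial ℝ F) A, MvPolynomial.cardinalMk_eq_max,
      Cardinal.mk_real, max_assoc, max_eq_left Cardinal.aleph0_le_continuum,
      max_eq_right (Cardinal.mk_le_aleph0.trans Cardinal.aleph0_le_continuum)]
  have hL : Cardinal.mk L = Cardinal.continuum := by
    apply le_antisymm
    · refine (Algebra.IsAlgebraic.cardinalMk_le_max A L).trans ?_
      rw [hA, max_eq_left Cardinal.aleph0_le_continuum]
    · rw [← hA]
      exact Cardinal.mk_le_of_injective (algebraMap A L).injective
  have hFA : Function.Injective ((algebraMap (MvPolynomial ℝ F) A).comp MvPolynomial.C) :=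
    RingHom.injective _
  have : CharZero A := charZero_of_injective_ringHom hFA
  have : CharZero L := charZero_of_injective_ringHom (algebraMap A L).injective
  obtain ⟨e⟩ := IsAlgClosed.ringEquiv_of_equiv_of_charZero (K := L) (L := ℂ)
    (hL ▸ Cardinal.aleph0_lt_continuum) (Cardinal.eq.mp (hL.trans Cardinal.mk_complex.symm))
  exact ⟨e.toRingHom.comp ((algebraMap A L).comp
    ((algebraMap (MvPolynomial ℝ F) A).comp MvPolynomial.C))⟩

theorem exists_injective_complex_matrix {n : Type} [Fintype n] [DecidableEq n] {K : Type}
    [Field K] [CharZero K] {G : Type} [Group G] [Finite G] (ρ : G →* Matrix n n K)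
    (hρ : Function.Injective ρ) :
    ∃ τ : G →* Matrix n n ℂ, Function.Injective τ := by
  let S : Set K := Set.range fun x : G × n × n => ρ x.1 x.2.1 x.2.2
  let F := IntermediateField.adjoin ℚ S
  have : Countable F := by
    rw [← Cardinal.mk_le_aleph0_iff]
    refine (IntermediateField.cardinalMk_adjoin_le ℚ S).trans ?_
    simp [S]
  obtain ⟨σ⟩ := nonempty_ringHom_complex_of_countable F
  have hmem : ∀ g i j, ρ g i j ∈ F := fun g i j =>
    IntermediateField.subset_adjoin ℚ S ⟨(g, i, j), rfl⟩
  let ρF : G →* Matrix n n F :=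
    { toFun := fun g => Matrix.of fun i j => ⟨ρ g i j, hmem g i j⟩
      map_one' := by
        ext i j
        by_cases h : i = j <;> simp [Matrix.one_apply, h]
      map_mul' := fun g h => by
        ext i j
        simp [Matrix.mul_apply] }
  refine ⟨σ.mapMatrix.toMonoidHom.comp ρF, fun g h hgh => hρ ?_⟩
  ext i j
  have : σ (ρF g i j) = σ (ρF h i j) := congrFun (congrFun hgh i) j
  exact congrArg Subtype.val (σ.injective this)

open scoped Matrix.Norms.L2Operator in
/-- **Jordan's theorem.** For every positive integer `n` there is a constant `J n` such that
for every field `K` of characteristic zero and every finite subgroup `G` of `GL n K`,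
there is an abelian normal subgroup `H` of `G` of index at most `J n`. -/
theorem jordan_theorem (n : ℕ) (hn : 0 < n) :
    ∃ J : ℕ, ∀ (K : Type) [Field K] [CharZero K]
      (G : Subgroup (GL (Fin n) K)), Finite G →
        ∃ H : Subgroup G, H.Normal ∧ (∀ a b : H, a * b = b * a) ∧ H.index ≤ J := by
  have : ProperSpace (Matrix (Fin n) (Fin n) ℂ) := FiniteDimensional.proper ℂ _
  obtain ⟨J, hJ⟩ := exists_index_le_of_injective_unitary (Matrix (Fin n) (Fin n) ℂ)
  refine ⟨J, fun K _ _ G _ => ?_⟩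
  obtain ⟨τ, hτ⟩ := exists_injective_complex_matrix ((Units.coeHom _).comp G.subtype)
    (Units.val_injective.comp G.subtype_injective)
  obtain ⟨φ, hφ⟩ := exists_injective_unitaryGroup_of_injective τ hτ
  exact hJ G φ hφ
end

section
/- Let K be a p-adic field, i.e. a finite extension of ℚ_p, and fix an algebraic closure K̄ of K. For every positive integer n, the set of intermediate fields L with K ⊆ L ⊆ K̄ such that [L : K] = n is finite. -/
open Polynomial IntermediateField

section Normed

variable {K : Type*} [NontriviallyNormedField K] [CompleteSpace K] [IsUltrametricDist K]

theorem norm_algEquiv {F : Type*} [NormedField F] [NormedAlgebra K F] [Algebra.IsAlgebraic K F]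
    (σ : F ≃ₐ[K] F) (z : F) : ‖σ z‖ = ‖z‖ := by
  rw [NormedAlgebra.norm_eq_spectralNorm K, NormedAlgebra.norm_eq_spectralNorm K,
    ← spectralNorm_eq_of_equiv]

/-- A nontrivial automorphism `g` of finite order moves some nonzero `x` by at least
`‖orderOf g‖ * ‖x‖`: take `x = y - g y ≠ 0` and compare `∑ i, g ^ i x = 0` with `orderOf g • x`. -/
theorem exists_ne_zero_norm_orderOf_mul_le_norm_sub {F : Type*} [NormedField F] [NormedAlgebra K F]
    [FiniteDimensional K F] {g : F ≃ₐ[K] F} (hg : g ≠ 1) :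
    ∃ x : F, x ≠ 0 ∧ ‖(orderOf g : F)‖ * ‖x‖ ≤ ‖g x - x‖ := by
  have : IsUltrametricDist F := IsUltrametricDist.of_normedAlgebra K
  obtain ⟨y, hy⟩ : ∃ y, g y ≠ y := by
    by_contra! h
    exact hg (AlgEquiv.ext h)
  refine ⟨y - g y, sub_ne_zero.mpr hy.symm, ?_⟩
  set x := y - g y with hx
  have hstep (i : ℕ) : ‖(g ^ i) x - x‖ ≤ ‖g x - x‖ := by
    induction i with
    | zero => simp
    | succ i ih =>
      have : (g ^ (i + 1)) x - x = (g ^ i) (g x - x) + ((g ^ i) x - x) := by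
        rw [pow_succ, AlgEquiv.mul_apply, map_sub (g ^ i) (g x) x, sub_add_sub_cancel]
      rw [this]
      exact (IsUltrametricDist.norm_add_le_max _ _).trans (max_le (norm_algEquiv _ _).le ih)
  have hsum : ∑ i ∈ Finset.range (orderOf g), (g ^ i) x = 0 := by
    have (i : ℕ) : (g ^ i) x = (g ^ i) y - (g ^ (i + 1)) y := by
      rw [hx, map_sub, pow_succ, AlgEquiv.mul_apply]
    simp_rw [this, Finset.sum_range_sub', pow_orderOf_eq_one]
    simp
  have hsub : (orderOf g : F) * x = -∑ i ∈ Finset.range (orderOf g), ((g ^ i) x - x) := by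
    rw [Finset.sum_sub_distrib, hsum]
    simp
  rw [← norm_mul, hsub, norm_neg]
  exact IsUltrametricDist.norm_sum_le_of_forall_le_of_nonneg (norm_nonneg _) fun i _ ↦ hstep i

/-- A nontrivial automorphism in a finite Galois group moves some `x` of norm at most one by an
amount bounded below in terms of the base field and the degree. -/
theorem exists_norm_le_one_norm_le_norm_sub {F : Type*} [NormedField F] [NormedAlgebra K F]
    [IsGalois K F] [FiniteDimensional K F] {c : K} (hc : 1 < ‖c‖) {g : F ≃ₐ[K] F} (hg : g ≠ 1) :
    ∃ x : F, ‖x‖ ≤ 1 ∧ ‖(Module.finrank K F : K) * c⁻¹‖ ≤ ‖g x - x‖ := by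
  have : IsUltrametricDist F := IsUltrametricDist.of_normedAlgebra K
  obtain ⟨x, hx, hgx⟩ := exists_ne_zero_norm_orderOf_mul_le_norm_sub hg
  obtain ⟨d, -, hd1, hd2, -⟩ := rescale_to_shell hc one_pos hx
  refine ⟨d • x, hd1.le, ?_⟩
  have hdvd : ‖(Module.finrank K F : K)‖ ≤ ‖(orderOf g : F)‖ := by
    obtain ⟨j, hj⟩ := (IsGalois.card_aut_eq_finrank K F) ▸ orderOf_dvd_natCard g
    rw [← norm_algebraMap' F, map_natCast, hj, Nat.cast_mul, norm_mul]
    exact mul_le_of_le_one_right (norm_nonneg _) (IsUltrametricDist.norm_natCast_le_one F j)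
  rw [map_smul, ← smul_sub, norm_smul, norm_mul, norm_inv]
  rw [one_div, norm_smul] at hd2
  calc _ ≤ ‖(orderOf g : F)‖ * (‖d‖ * ‖x‖) := by gcongr
    _ = ‖d‖ * (‖(orderOf g : F)‖ * ‖x‖) := by ring
    _ ≤ _ := by gcongr

/-- In a finite Galois extension there is an element of norm at most one whose distance to all its
other conjugates is bounded below by a constant depending only on the base field and the degree. -/
theorem exists_norm_le_one_forall_norm_le_norm_sub {F : Type*} [NormedField F] [NormedAlgebra K F]
    [IsGalois K F] [FiniteDimensional K F] [CharZero K] {c : K} (hc : 1 < ‖c‖) :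
    ∃ x : F, ‖x‖ ≤ 1 ∧ ∀ g : F ≃ₐ[K] F, g ≠ 1 →
      ‖((Module.finrank K F : K) * c⁻¹ * c⁻¹) ^ Module.finrank K F‖ ≤ ‖g x - x‖ := by
  classical
  have : IsUltrametricDist F := IsUltrametricDist.of_normedAlgebra K
  set n := Module.finrank K F with hn
  set b : K := n * c⁻¹ with hb
  have hc0 : 0 < ‖c‖ := one_pos.trans hc
  have hcinv : ‖c⁻¹‖ < 1 := by rw [norm_inv]; exact inv_lt_one_of_one_lt₀ hc
  have hcn0 : c ≠ 0 := norm_pos_iff.mp hc0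
  have hn0 : (n : K) ≠ 0 := Nat.cast_ne_zero.mpr Module.finrank_pos.ne'
  have hb0 : b ≠ 0 := mul_ne_zero hn0 (inv_ne_zero hcn0)
  have hb1 : ‖b‖ ≤ 1 := by
    rw [hb, norm_mul]
    exact mul_le_one₀ (IsUltrametricDist.norm_natCast_le_one K n) (norm_nonneg _) hcinv.le
  have hbc : ‖b * c⁻¹‖ ≤ 1 := by
    rw [norm_mul]; exact mul_le_one₀ hb1 (norm_nonneg _) hcinv.le
  have key (T : Finset (F ≃ₐ[K] F)) (hT : (1 : F ≃ₐ[K] F) ∉ T) :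
      ∃ x : F, ‖x‖ ≤ 1 ∧ ∀ g ∈ T, ‖(b * c⁻¹) ^ T.card‖ ≤ ‖g x - x‖ := by
    induction T using Finset.induction_on with
    | empty => exact ⟨0, by simp⟩
    | insert h T hhT ih =>
      simp only [Finset.mem_insert, not_or] at hT
      obtain ⟨x, hx1, hx⟩ := ih hT.2
      obtain ⟨y, hy1, hy⟩ := exists_norm_le_one_norm_le_norm_sub hc (Ne.symm hT.1)
      rw [Finset.card_insert_of_notMem hhT]
      set e : K := (b * c⁻¹) ^ T.card with he
      have he1 : ‖e‖ ≤ 1 := by rw [he, norm_pow]; exact pow_le_one₀ (norm_nonneg _) hbc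
      have he0 : e ≠ 0 := pow_ne_zero _ (mul_ne_zero hb0 (inv_ne_zero hcn0))
      have hpow : ‖(b * c⁻¹) ^ (T.card + 1)‖ = ‖e * c⁻¹‖ * ‖b‖ := by
        rw [pow_succ, ← he, ← norm_mul]; ring_nf
      have hle : ‖(b * c⁻¹) ^ (T.card + 1)‖ ≤ ‖e‖ := by
        rw [pow_succ, norm_mul]; exact mul_le_of_le_one_right (norm_nonneg _) hbc
      by_cases hhx : ‖(b * c⁻¹) ^ (T.card + 1)‖ ≤ ‖h x - x‖
      · refine ⟨x, hx1, fun g hg ↦ ?_⟩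
        rcases Finset.mem_insert.mp hg with rfl | hg
        · exact hhx
        · exact hle.trans (hx g hg)
      · have hec : ‖e * c⁻¹‖ < ‖e‖ := by
          rw [norm_mul]; exact mul_lt_of_lt_one_right (norm_pos_iff.mpr he0) hcinv
        have hdecomp (g : F ≃ₐ[K] F) : g (x + (e * c⁻¹) • y) - (x + (e * c⁻¹) • y) =
            (g x - x) + (e * c⁻¹) • (g y - y) := by
          rw [map_add, map_smul, smul_sub]; ring
        refine ⟨x + (e * c⁻¹) • y, ?_, fun g hg ↦ ?_⟩
        · refine (IsUltrametricDist.norm_add_le_max _ _).trans (max_le hx1 ?_)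
          rw [norm_smul]
          exact mul_le_one₀ (hec.le.trans he1) (norm_nonneg _) hy1
        · rw [hdecomp]
          rcases Finset.mem_insert.mp hg with rfl | hg
          · have h1 : ‖(b * c⁻¹) ^ (T.card + 1)‖ ≤ ‖(e * c⁻¹) • (g y - y)‖ := by
              rw [hpow, norm_smul]; gcongr
            rw [IsUltrametricDist.norm_add_eq_max_of_norm_ne_norm
              ((not_le.mp hhx).trans_le h1).ne]
            exact h1.trans (le_max_right _ _)
          · have hy2 : ‖g y - y‖ ≤ 1 := by
              rw [sub_eq_add_neg]
              refine (IsUltrametricDist.norm_add_le_max _ _).trans (max_le ?_ ?_)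
              · rwa [norm_algEquiv]
              · rwa [norm_neg]
            have h2 : ‖(e * c⁻¹) • (g y - y)‖ < ‖g x - x‖ := by
              rw [norm_smul]
              exact (mul_le_of_le_one_right (norm_nonneg _) hy2).trans_lt
                (hec.trans_le (hx g hg))
            rw [IsUltrametricDist.norm_add_eq_max_of_norm_ne_norm h2.ne']
            exact (hle.trans (hx g hg)).trans (le_max_left _ _)
  obtain ⟨x, hx1, hx⟩ := key (Finset.univ.erase 1) (by simp)
  refine ⟨x, hx1, fun g hg ↦ le_trans ?_ (hx g (by simpa using hg))⟩
  rw [norm_pow, norm_pow]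
  refine pow_le_pow_of_le_one (norm_nonneg _) hbc ?_
  rw [hn, ← IsGalois.card_aut_eq_finrank K F, Nat.card_eq_fintype_card]
  exact Finset.card_le_univ _

theorem norm_coeff_minpoly_le_one {L : Type*} [NormedField L] [NormedAlgebra K L]
    [Algebra.IsAlgebraic K L] {x : L} (hx : ‖x‖ ≤ 1) (i : ℕ) : ‖(minpoly K x).coeff i‖ ≤ 1 := by
  rw [NormedAlgebra.norm_eq_spectralNorm K, spectralNorm,
    spectralValue_le_one_iff (minpoly.monic (Algebra.IsIntegral.isIntegral x))] at hx
  exact hx i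

/-- A proper nonarchimedean field of characteristic zero has only finitely many Galois extensions
of given degree inside an algebraic closure. -/
theorem finite_setOf_isGalois_finrank_eq [CharZero K] [ProperSpace K] {C : Type*} [NormedField C]
    [NormedAlgebra K C] [IsAlgClosed C] [Algebra.IsAlgebraic K C] {n : ℕ} (hn : 0 < n) :
    {F : IntermediateField K C | IsGalois K F ∧ Module.finrank K F = n}.Finite := by
  have : IsAlgClosure K C := ⟨inferInstance, inferInstance⟩
  obtain ⟨c, hc⟩ := NormedField.exists_one_lt_norm K
  have hc0 : c ≠ 0 := norm_pos_iff.mp (one_pos.trans hc)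
  set δ : ℝ := ‖((n : K) * c⁻¹ * c⁻¹) ^ n‖ with hδ
  have hδ0 : 0 < δ := by
    rw [hδ, norm_pos_iff]
    have : (n : K) ≠ 0 := Nat.cast_ne_zero.mpr hn.ne'
    positivity
  set S := {F : IntermediateField K C | IsGalois K F ∧ Module.finrank K F = n}
  have hα (F : S) : ∃ x : C, ‖x‖ ≤ 1 ∧ K⟮x⟯ = F.1 ∧
      ∀ x' : C, IsConjRoot K x x' → x ≠ x' → δ ≤ ‖x - x'‖ := by
    obtain ⟨F, hF, hFn⟩ := F
    have : FiniteDimensional K F := Module.finite_of_finrank_pos (hFn ▸ hn)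
    obtain ⟨x, hx1, hx⟩ := exists_norm_le_one_forall_norm_le_norm_sub (F := F) hc
    rw [hFn, ← hδ] at hx
    refine ⟨x, hx1, ?_, fun x' hx' hne ↦ ?_⟩
    · have : K⟮x⟯ = ⊤ := by
        rw [← IsGalois.fixedField_fixingSubgroup K⟮x⟯]
        have : K⟮x⟯.fixingSubgroup = ⊥ := by
          rw [eq_bot_iff]
          intro g hg
          by_contra hg1
          have h := hx g hg1
          have hgx : g x = x := hg ⟨x, mem_adjoin_simple_self K x⟩
          rw [hgx, sub_self, norm_zero] at h
          exact h.not_gt hδ0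
        rw [this, fixedField_bot]
      rw [← lift_adjoin_simple, this, lift_top]
    · obtain ⟨σ, rfl⟩ := isConjRoot_iff_exists_algEquiv.mp hx'.symm
      have hcomm : ((σ.restrictNormal F x : F) : C) = σ x := σ.restrictNormal_commutes F x
      rw [← hcomm, norm_sub_rev]
      refine hx (σ.restrictNormal F) fun h ↦ hne ?_
      rw [← hcomm, h, AlgEquiv.one_apply]
  choose α hα1 hαF hαδ using hα
  have hint (x : C) : IsIntegral K x := Algebra.IsIntegral.isIntegral x
  have hdeg (F : S) : (minpoly K (α F)).natDegree = n := by
    rw [← adjoin.finrank (hint _), hαF, F.2.2]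
  set v : S → Fin (n + 1) → K := fun F i ↦ (minpoly K (α F)).coeff i
  set ε : ℝ := δ ^ n / (n + 1) with hε
  have hε0 : 0 < ε := by positivity
  obtain ⟨t, -, ht, hcover⟩ :=
    (isCompact_closedBall (0 : Fin (n + 1) → K) 1).finite_cover_balls (half_pos hε0)
  have hle (F G : S) (w) (hF : v F ∈ Metric.ball w (ε / 2)) (hG : v G ∈ Metric.ball w (ε / 2)) :
      F.1 ≤ G.1 := by
    have hdist : dist (v G) (v F) < ε :=
      (dist_triangle_right _ _ w).trans_lt (add_halves ε ▸ add_lt_add hG hF)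
    have hcoeff (i : ℕ) : ‖(minpoly K (α G)).coeff i - (minpoly K (α F)).coeff i‖ < ε := by
      by_cases hi : i < n + 1
      · rw [← dist_eq_norm]
        exact (dist_le_pi_dist (v G) (v F) ⟨i, hi⟩).trans_lt hdist
      · rw [coeff_eq_zero_of_natDegree_lt (by rw [hdeg]; omega),
          coeff_eq_zero_of_natDegree_lt (by rw [hdeg]; omega)]
        simpa using hε0
    obtain ⟨β, hβ, hαβ⟩ := exists_aroots_norm_sub_lt_of_norm_coeff_sub_lt hε0
      (minpoly.aeval K (α F)) (minpoly.monic (hint _)) (minpoly.monic (hint _))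
      ((hdeg G).trans (hdeg F).symm) hcoeff (IsAlgClosed.splits _)
    rw [hdeg, max_eq_right (hα1 F), mul_one, hε, mul_div_cancel₀ _ (by positivity),
      Real.pow_rpow_inv_natCast hδ0.le hn.ne'] at hαβ
    have hβG : β ∈ G.1 := by
      have := G.2.1
      obtain ⟨σ, rfl⟩ := isConjRoot_iff_exists_algEquiv.mp
        ((isConjRoot_iff_mem_minpoly_aroots (hint (α G))).mpr hβ).symm
      have hmem : α G ∈ G.1 := hαF G ▸ mem_adjoin_simple_self K _
      have hcomm : ((σ.restrictNormal G.1 ⟨α G, hmem⟩ : G.1) : C) = σ (α G) :=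
        σ.restrictNormal_commutes G.1 ⟨α G, hmem⟩
      exact hcomm ▸ SetLike.coe_mem _
    rw [← hαF F, adjoin_simple_le_iff]
    exact adjoin_simple_le_iff.mpr hβG (IsKrasner.krasner (minpoly.irreducible (hint _)).separable
      (IsAlgClosed.splits _) (hint β) fun x' h h' ↦ hαβ.trans_le (hαδ F x' h h'))
  have hex (F : S) : ∃ w : t, v F ∈ Metric.ball w.1 (ε / 2) := by
    have : v F ∈ Metric.closedBall (0 : Fin (n + 1) → K) 1 := by
      rw [mem_closedBall_zero_iff, pi_norm_le_iff_of_nonneg zero_le_one]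
      exact fun i ↦ norm_coeff_minpoly_le_one (hα1 F) i
    simpa using hcover this
  choose w hw using hex
  have := ht.to_subtype
  exact Set.finite_coe_iff.mp <| Finite.of_injective w fun F G h ↦
    Subtype.ext (le_antisymm (hle F G _ (hw F) (h ▸ hw G)) (hle G F _ (hw G) (h ▸ hw F)))

end Normed

section Closure

variable {K C : Type*} [Field K] [CharZero K] [Field C] [Algebra K C] [IsAlgClosed C]

/-- A finite extension of degree `n` lies in a Galois extension of degree at most `n!`. -/
theorem exists_isGalois_finrank_le_factorial (L : IntermediateField K C) [FiniteDimensional K L] :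
    ∃ F : IntermediateField K C, L ≤ F ∧ IsGalois K F ∧ 0 < Module.finrank K F ∧
      Module.finrank K F ≤ (Module.finrank K L).factorial := by
  obtain ⟨x, hx⟩ := Field.exists_primitive_element K L
  have hxi : IsIntegral K x := Algebra.IsIntegral.isIntegral x
  set f := minpoly K x with hf
  have hsep : f.Separable := (minpoly.irreducible hxi).separable
  have hsplit : (f.map (algebraMap K C)).Splits := IsAlgClosed.splits _
  set F : IntermediateField K C := IntermediateField.adjoin K (f.rootSet C) with hF
  have hsf : IsSplittingField K F f := adjoin_rootSet_isSplittingField hsplit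
  have hgal : IsGalois K F := IsGalois.of_separable_splitting_field hsep
  have : FiniteDimensional K F := IsSplittingField.finiteDimensional F f
  refine ⟨F, ?_, hgal, Module.finrank_pos, ?_⟩
  · have : L = K⟮(x : C)⟯ := by rw [← lift_adjoin_simple, hx, lift_top]
    rw [this, adjoin_simple_le_iff]
    refine subset_adjoin K _ (mem_rootSet.mpr ⟨minpoly.ne_zero hxi, ?_⟩)
    rw [hf, ← minpoly.algebraMap_eq (algebraMap L C).injective x]
    exact minpoly.aeval K _
  · have := Fact.mk hsplit
    have e := (IsSplittingField.algEquiv F f).toLinearEquiv.finrank_eq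
    rw [e, ← Gal.card_of_separable hsep]
    refine (Nat.card_le_card_of_injective _ (Gal.galActionHom_injective f C)).trans ?_
    rw [Nat.card_perm]
    refine Nat.factorial_le ?_
    rw [← finrank_top', ← hx, adjoin.finrank hxi, Nat.card_coe_set_eq]
    exact ncard_rootSet_le f C

theorem finite_setOf_finrank_eq_of_finite_setOf_isGalois
    (h : ∀ n, 0 < n → {F : IntermediateField K C | IsGalois K F ∧ Module.finrank K F = n}.Finite)
    {n : ℕ} (hn : 0 < n) : {L : IntermediateField K C | Module.finrank K L = n}.Finite := by
  have hfin : (⋃ m ∈ Finset.Icc 1 n.factorial, ⋃ F ∈ {F : IntermediateField K C | IsGalois K F ∧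
      Module.finrank K F = m}, Set.Iic F).Finite := by
    refine (Finset.finite_toSet _).biUnion fun m hm ↦ ?_
    have hm : 0 < m := (Finset.mem_Icc.mp hm).1
    refine (h m hm).biUnion fun F hF ↦ ?_
    have : FiniteDimensional K F := Module.finite_of_finrank_pos (hF.2 ▸ hm)
    have := Field.finite_intermediateField_of_exists_primitive_element K F
      (Field.exists_primitive_element K F)
    exact (Set.finite_range lift).subset fun L hL ↦ ⟨restrict hL, lift_restrict hL⟩
  refine hfin.subset fun L hL ↦ ?_
  rw [Set.mem_ofPred_eq] at hL
  have : FiniteDimensional K L := Module.finite_of_finrank_pos (hL ▸ hn)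
  obtain ⟨F, hLF, hF, hpos, hfac⟩ := exists_isGalois_finrank_le_factorial L
  simp only [Set.mem_iUnion]
  exact ⟨_, Finset.mem_Icc.mpr ⟨hpos, hL ▸ hfac⟩, F, ⟨hF, rfl⟩, hLF⟩

end Closure

/-- Let `K` be a `p`-adic field (a finite extension of `ℚ_[p]`) with a fixed algebraic
closure `Kbar`. For every positive integer `n`, there are only finitely many intermediate
fields `L` of `Kbar / K` with `[L : K] = n`. -/
theorem finitely_many_extensions_of_degree
    (p : ℕ) [Fact p.Prime] (K : Type) [Field K] [Algebra ℚ_[p] K]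
    [FiniteDimensional ℚ_[p] K]
    (Kbar : Type) [Field Kbar] [Algebra K Kbar] [IsAlgClosure K Kbar]
    (n : ℕ) (hn : 0 < n) :
    {L : IntermediateField K Kbar | Module.finrank K L = n}.Finite := by
  let : Algebra ℚ_[p] Kbar := ((algebraMap K Kbar).comp (algebraMap ℚ_[p] K)).toAlgebra
  have : IsScalarTower ℚ_[p] K Kbar := .of_algebraMap_eq fun _ ↦ rfl
  have : IsAlgClosed Kbar := IsAlgClosure.isAlgClosed K
  have : Algebra.IsAlgebraic K Kbar := IsAlgClosure.isAlgebraic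
  have : Algebra.IsAlgebraic ℚ_[p] Kbar := .trans ℚ_[p] K Kbar
  have hfin : {L : IntermediateField ℚ_[p] Kbar |
      Module.finrank ℚ_[p] L = Module.finrank ℚ_[p] K * n}.Finite := by
    let : NormedField Kbar := spectralNorm.normedField ℚ_[p] Kbar
    let : NormedAlgebra ℚ_[p] Kbar := spectralNorm.normedAlgebra ℚ_[p] Kbar
    exact finite_setOf_finrank_eq_of_finite_setOf_isGalois
      (fun _ ↦ finite_setOf_isGalois_finrank_eq) (Nat.mul_pos Module.finrank_pos hn)
  refine Set.Finite.of_finite_image (f := IntermediateField.restrictScalars ℚ_[p])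
    (hfin.subset ?_) (restrictScalars_injective ℚ_[p]).injOn
  rintro _ ⟨L, rfl, rfl⟩
  exact (Module.finrank_mul_finrank ℚ_[p] K L).symm
end

section
/- Let K be a finite extension of ℚ_p with a fixed algebraic closure K̄, and let n be a positive integer. Then there exists a finite Galois extension L of K inside K̄ such that every intermediate field M with K ⊆ M ⊆ K̄ and [M : K] ≤ n is contained in L. -/
open Module Polynomial

theorem norm_algebraNorm_eq_spectralNorm_pow (p : ℕ) [Fact p.Prime] {M : Type*} [Field M]
    [Algebra ℚ_[p] M] [FiniteDimensional ℚ_[p] M] (x : M) :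
    ‖Algebra.norm ℚ_[p] x‖ = spectralNorm ℚ_[p] M x ^ finrank ℚ_[p] M := by
  have key (σ : M →ₐ[ℚ_[p]] PadicAlgCl p) : ‖σ x‖ = spectralNorm ℚ_[p] M x := by
    rw [NormedAlgebra.norm_eq_spectralNorm ℚ_[p], spectralNorm, spectralNorm,
      minpoly.algHom_eq σ σ.injective]
  rw [← norm_algebraMap' (PadicAlgCl p), Algebra.norm_eq_prod_embeddings ℚ_[p] (PadicAlgCl p) x,
    norm_prod, Finset.prod_congr rfl fun σ _ ↦ key σ, Finset.prod_const, Finset.card_univ,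
    AlgHom.card]

theorem PadicInt.isIntegral_of_spectralNorm_le_one (p : ℕ) [Fact p.Prime] {M : Type*} [Field M]
    [Algebra ℚ_[p] M] [Algebra.IsAlgebraic ℚ_[p] M] [Algebra ℤ_[p] M]
    [IsScalarTower ℤ_[p] ℚ_[p] M] {x : M}
    (hx : spectralNorm ℚ_[p] M x ≤ 1) : IsIntegral ℤ_[p] x := by
  have hmon := minpoly.monic (Algebra.IsIntegral.isIntegral (R := ℚ_[p]) x)
  rw [spectralNorm, spectralValue_le_one_iff hmon] at hx
  have hl : minpoly ℚ_[p] x ∈ lifts (algebraMap ℤ_[p] ℚ_[p]) :=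
    (lifts_iff_coeff_lifts _).mpr fun n ↦ ⟨⟨_, hx n⟩, rfl⟩
  obtain ⟨q, hq, -, hqm⟩ := lifts_and_natDegree_eq_and_monic hl hmon
  refine ⟨q, hqm, ?_⟩
  rw [IsScalarTower.algebraMap_eq ℤ_[p] ℚ_[p] M, ← eval₂_map, hq, ← aeval_def, minpoly.aeval]

theorem Padic.exists_basis_norm_repr_le (p : ℕ) [Fact p.Prime] (M : Type*) [Field M]
    [Algebra ℚ_[p] M] [FiniteDimensional ℚ_[p] M] {d : ℕ} (hd : finrank ℚ_[p] M = d) :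
    ∃ b : Basis (Fin d) ℚ_[p] M, (∀ i j k, ‖b.repr (b i * b j) k‖ ≤ 1) ∧
      (∀ k, ‖b.repr 1 k‖ ≤ 1) ∧ ∀ x k, ‖b.repr x k‖ ≤ p * spectralNorm ℚ_[p] M x := by
  let : Algebra ℤ_[p] M := ((algebraMap ℚ_[p] M).comp (algebraMap ℤ_[p] ℚ_[p])).toAlgebra
  have : IsScalarTower ℤ_[p] ℚ_[p] M := .of_algebraMap_eq fun _ ↦ rfl
  have : IsTorsionFree ℤ_[p] M := .trans_faithfulSMul ℤ_[p] ℚ_[p] M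
  let C := integralClosure ℤ_[p] M
  have := IsIntegralClosure.module_free ℤ_[p] ℚ_[p] M C
  have := IsIntegralClosure.finite ℤ_[p] ℚ_[p] M C
  have hr := IsIntegralClosure.rank ℤ_[p] ℚ_[p] M C
  have : IsLocalization (Algebra.algebraMapSubmonoid C (nonZeroDivisors ℤ_[p])) M :=
    IsIntegralClosure.isLocalization ℤ_[p] ℚ_[p] M C
  let b₀ : Basis (Fin d) ℤ_[p] C := finBasisOfFinrankEq ℤ_[p] C (hr.trans hd)
  let b := b₀.localizationLocalization ℚ_[p] (nonZeroDivisors ℤ_[p]) M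
  have hb (x : M) (hx : IsIntegral ℤ_[p] x) (k) : ‖b.repr x k‖ ≤ 1 := by
    have := b₀.localizationLocalization_repr_algebraMap ℚ_[p] (nonZeroDivisors ℤ_[p]) M ⟨x, hx⟩ k
    change b.repr x k = _ at this
    rw [this]
    exact PadicInt.norm_le_one _
  have hbi (i) : IsIntegral ℤ_[p] (b i) := by
    rw [Basis.localizationLocalization_apply]
    exact (b₀ i).2
  refine ⟨b, fun i j ↦ hb _ ((hbi i).mul (hbi j)), hb _ isIntegral_one, fun x k ↦ ?_⟩
  rcases eq_or_ne x 0 with rfl | hx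
  · simp [spectralNorm_zero]
  have hp1 : (1 : ℝ) < p := by exact_mod_cast (Fact.out : p.Prime).one_lt
  obtain ⟨n, hn1, hn2⟩ := exists_mem_Ioc_zpow
    (spectralNorm_zero_lt (K := ℚ_[p]) hx (Algebra.IsAlgebraic.isAlgebraic x)) hp1
  have h1 : spectralNorm ℚ_[p] M ((p : ℚ_[p]) ^ (n + 1) • x) ≤ 1 := by
    rw [spectralNorm_smul _ (Algebra.IsAlgebraic.isAlgebraic x), coe_nnnorm, Padic.norm_p_zpow,
      zpow_neg]
    exact inv_mul_le_one_of_le₀ hn2 (by positivity)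
  have h2 := hb _ (PadicInt.isIntegral_of_spectralNorm_le_one p h1) k
  rw [map_smul, Finsupp.smul_apply, norm_smul, Padic.norm_p_zpow, zpow_neg,
    inv_mul_le_iff₀ (by positivity), mul_one, zpow_add_one₀ (by positivity),
      mul_comm] at h2
  exact h2.trans (by gcongr)

theorem Polynomial.exists_adjoin_root_le_of_coeff_near (p : ℕ) [Fact p.Prime] (Ω : Type*) [Field Ω]
    [Algebra ℚ_[p] Ω] [IsAlgClosure ℚ_[p] Ω] {f : ℚ_[p][X]} (hf : f.Monic) (hirr : Irreducible f) :
    ∃ ε > 0, ∀ g : ℚ_[p][X], g.Monic → g.natDegree = f.natDegree →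
      (∀ i, ‖g.coeff i - f.coeff i‖ < ε) → ∀ β : Ω, aeval β g = 0 →
      IntermediateField.adjoin ℚ_[p] {β} ≤ IntermediateField.adjoin ℚ_[p] (f.rootSet Ω) ∧
      finrank ℚ_[p] (IntermediateField.adjoin ℚ_[p] {β}) = f.natDegree := by
  have : IsAlgClosed Ω := IsAlgClosure.isAlgClosed ℚ_[p]
  have : Algebra.IsAlgebraic ℚ_[p] Ω := IsAlgClosure.isAlgebraic
  have : Normal ℚ_[p] Ω := IsAlgClosure.normal ℚ_[p] Ω
  let : NormedField Ω := spectralNorm.normedField ℚ_[p] Ω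
  let : NormedAlgebra ℚ_[p] Ω := spectralNorm.normedAlgebra ℚ_[p] Ω
  obtain ⟨a, ha⟩ := IsAlgClosed.exists_aeval_eq_zero Ω f hirr.degree_pos.ne'
  have hmin : f = minpoly ℚ_[p] a := minpoly.eq_of_irreducible_of_monic hirr ha hf
  have hsep : ∃ δ > 0, ∀ a' ∈ f.rootSet Ω, a ≠ a' → δ ≤ ‖a - a'‖ := by
    have hfin : ((fun a' ↦ ‖a - a'‖) '' (f.rootSet Ω \ {a})).Finite :=
      ((f.rootSet_finite Ω).sdiff).image _
    have h0 : (0 : ℝ) ∉ (fun a' ↦ ‖a - a'‖) '' (f.rootSet Ω \ {a}) := by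
      rintro ⟨a', ⟨-, h⟩, h'⟩
      exact h (sub_eq_zero.mp (norm_eq_zero.mp h')).symm
    obtain ⟨δ, hδ, hb⟩ := Metric.isOpen_iff.mp hfin.isClosed.isOpen_compl 0 h0
    refine ⟨δ, hδ, fun a' ha' hne ↦ le_of_not_gt fun hlt ↦ ?_⟩
    exact hb (a := ‖a - a'‖) (by simpa using hlt) ⟨a', ⟨ha', fun h ↦ hne h.symm⟩, rfl⟩
  obtain ⟨δ, hδ, hsep⟩ := hsep
  have hdeg : f.natDegree ≠ 0 := hirr.natDegree_pos.ne'
  have hε : (δ / max ‖a‖ 1) ^ f.natDegree / (f.natDegree + 1) > 0 := by positivity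
  refine ⟨_, hε, fun g hgm hgd hgc β hβ ↦ ?_⟩
  obtain ⟨b, hb, hab⟩ := exists_aroots_norm_sub_lt_of_norm_coeff_sub_lt
    hε ha hf hgm hgd hgc (IsAlgClosed.splits _)
  have hab : ‖a - b‖ < δ := by
    rwa [mul_div_cancel₀ _ (by positivity), Real.pow_rpow_inv_natCast (by positivity) hdeg,
      div_mul_cancel₀ _ (by positivity)] at hab
  have hb0 : aeval b g = 0 := (mem_aroots.mp hb).2
  have hab' : a ∈ IntermediateField.adjoin ℚ_[p] {b} := by
    refine IsKrasner.krasner (hmin ▸ hirr.separable) (IsAlgClosed.splits _)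
      (Algebra.IsIntegral.isIntegral b) fun a' hc hne ↦ hab.trans_le (hsep a' ?_ hne)
    rw [hmin]
    exact (isConjRoot_iff_mem_minpoly_rootSet (Algebra.IsIntegral.isIntegral a)).mp hc
  have hle : IntermediateField.adjoin ℚ_[p] {a} ≤ IntermediateField.adjoin ℚ_[p] {b} := by
    simpa using hab'
  have hbint := Algebra.IsIntegral.isIntegral (R := ℚ_[p]) b
  have := IntermediateField.adjoin.finiteDimensional hbint
  have hfa := IntermediateField.adjoin.finrank (Algebra.IsIntegral.isIntegral (R := ℚ_[p]) a)
  have hfb := IntermediateField.adjoin.finrank hbint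
  have hda : (minpoly ℚ_[p] a).natDegree ≤ (minpoly ℚ_[p] b).natDegree := by
    rw [← hfa, ← hfb]
    exact IntermediateField.finrank_le_of_le_right hle
  have hg : g = minpoly ℚ_[p] b := by
    refine (eq_of_monic_of_dvd_of_natDegree_le (minpoly.monic hbint) hgm (minpoly.dvd _ _ hb0)
      ?_)
    rwa [hgd, hmin]
  have heq : IntermediateField.adjoin ℚ_[p] {a} = IntermediateField.adjoin ℚ_[p] {b} := by
    refine IntermediateField.eq_of_le_of_finrank_eq hle ?_
    rw [hfa, hfb, ← hmin, ← hg, hgd]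
  have hβm : g = minpoly ℚ_[p] β :=
    minpoly.eq_of_irreducible_of_monic (hg ▸ minpoly.irreducible hbint) hβ hgm
  obtain ⟨σ, hσ⟩ := isConjRoot_iff_exists_algEquiv.mp
    (show IsConjRoot ℚ_[p] β b from hβm.symm.trans hg)
  refine ⟨?_, ?_⟩
  · rw [IntermediateField.adjoin_simple_le_iff]
    have hba : b ∈ IntermediateField.adjoin ℚ_[p] {a} :=
      heq ▸ IntermediateField.mem_adjoin_simple_self _ b
    have h1 : σ b ∈ (IntermediateField.adjoin ℚ_[p] {a}).map σ.toAlgHom := ⟨b, hba, rfl⟩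
    rw [IntermediateField.adjoin_map, Set.image_singleton] at h1
    rw [← hσ]
    refine IntermediateField.adjoin.mono _ _ _ ?_ h1
    rw [Set.singleton_subset_iff, mem_rootSet]
    exact ⟨hf.ne_zero, by simpa using! (aeval_algHom_apply σ.toAlgHom a f).trans (by simp [ha])⟩
  · rw [IntermediateField.adjoin.finrank (Algebra.IsIntegral.isIntegral (R := ℚ_[p]) β), ← hβm, hgd]

theorem IntermediateField.exists_finiteDimensional_of_restrictScalars
    {k K Ω : Type*} [Field k] [Field K] [Field Ω] [CharZero K] [Algebra k K] [Algebra K Ω]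
    [Algebra k Ω] [IsScalarTower k K Ω] [IsAlgClosure K Ω]
    (F : IntermediateField k Ω) [FiniteDimensional k F] :
    ∃ L : IntermediateField K Ω, FiniteDimensional K L ∧ IsGalois K L ∧ (F : Set Ω) ⊆ L := by
  have : IsAlgClosed Ω := IsAlgClosure.isAlgClosed K
  have : Algebra.IsAlgebraic K Ω := IsAlgClosure.isAlgebraic
  have : Normal K Ω := IsAlgClosure.normal K Ω
  obtain ⟨s, hs⟩ := IntermediateField.essFiniteType_iff.mp
    (inferInstance : Algebra.EssFiniteType k F)
  let E := IntermediateField.adjoin K (s : Set Ω)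
  have : FiniteDimensional K E :=
    IntermediateField.finiteDimensional_adjoin fun x _ ↦ Algebra.IsIntegral.isIntegral x
  refine ⟨normalClosure K E Ω, inferInstance, inferInstance, ?_⟩
  have h1 : E ≤ normalClosure K E Ω := IntermediateField.le_normalClosure E
  have h2 : F ≤ E.restrictScalars k := by
    rw [← hs, IntermediateField.adjoin_le_iff]
    exact IntermediateField.subset_adjoin K _
  exact fun x hx ↦ h1 (h2 hx)

theorem Matrix.continuous_charpoly_coeff {n R : Type*} [Fintype n] [DecidableEq n] [CommRing R]
    [TopologicalSpace R] [IsTopologicalRing R] (i : ℕ) :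
    Continuous fun A : Matrix n n R ↦ A.charpoly.coeff i := by
  have h (A : Matrix n n R) : A.charpoly.coeff i =
      MvPolynomial.eval (fun ij : n × n ↦ A ij.1 ij.2) ((Matrix.charpoly.univ R n).coeff i) :=
    (Matrix.charpoly.univ_coeff_eval₂Hom n (RingHom.id R) (fun ij : n × n ↦ A ij.1 ij.2) i).symm
  simp only [h]
  exact (MvPolynomial.continuous_eval _).comp (by fun_prop)

open scoped IsMulCommutative in
theorem Subalgebra.exists_irreducible_charpoly {k n : Type*} [Field k] [PerfectField k] [Fintype n]
    [DecidableEq n] (S : Subalgebra k (Matrix n n k)) [IsMulCommutative S]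
    (hdet : ∀ x ∈ S, x.det = 0 → x = 0) (hS : finrank k S = Fintype.card n) [Nonempty n] :
    ∃ x ∈ S, Irreducible x.charpoly := by
  have : NoZeroDivisors S := ⟨by
    intro x y hxy
    have hxy' := congrArg Matrix.det (congrArg Subtype.val hxy)
    rw [Subalgebra.coe_mul, Matrix.det_mul, Subalgebra.coe_zero,
      Matrix.det_zero, mul_eq_zero] at hxy'
    exact hxy'.imp (fun h ↦ Subtype.ext (hdet x x.2 h)) (fun h ↦ Subtype.ext (hdet y y.2 h))⟩
  have : IsDomain S := NoZeroDivisors.to_isDomain S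
  let : Field S := fieldOfFiniteDimensional k S
  obtain ⟨θ, hθ⟩ := Field.exists_primitive_element k S
  rw [Field.primitive_element_iff_minpoly_natDegree_eq, hS] at hθ
  have hmin : minpoly k θ.1 = minpoly k θ :=
    minpoly.algHom_eq S.val Subtype.val_injective θ
  have hθi := Algebra.IsIntegral.isIntegral (R := k) θ
  refine ⟨θ, θ.2, ?_⟩
  rw [eq_of_monic_of_dvd_of_natDegree_le (minpoly.monic hθi) (Matrix.charpoly_monic θ.1)
    (hmin ▸ Matrix.minpoly_dvd_charpoly θ.1) (by rw [Matrix.charpoly_natDegree_eq_dim, hθ])]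
  exact minpoly.irreducible hθi

/-- `A` and `u` are the left multiplication matrices of the basis vectors and the coordinates of
`1` of a `d`-dimensional field extension of `ℚ_[p]`, in a basis for which the coordinates of an
element `x` are bounded by `p` times the norm of `x`. Every condition is closed in `(A, u)`. -/
structure Padic.IsFieldTable (p : ℕ) [Fact p.Prime] {d : ℕ}
    (A : Fin d → Matrix (Fin d) (Fin d) ℚ_[p]) (u : Fin d → ℚ_[p]) : Prop where
  norm_le (i j k) : ‖A i j k‖ ≤ 1
  norm_unit_le (i) : ‖u i‖ ≤ 1
  mul_eq (i j) : A i * A j = ∑ k, A i k j • A k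
  comm (i j) : A i * A j = A j * A i
  sum_unit : ∑ i, u i • A i = 1
  le_norm_det (c : Fin d → ℚ_[p]) (i) : ‖c i‖ ^ d ≤ (p : ℝ) ^ d * ‖(∑ j, c j • A j).det‖

namespace Padic

variable {p : ℕ} [Fact p.Prime] {d : ℕ}

theorem isCompact_setOf_isFieldTable :
    IsCompact {x : (Fin d → Matrix (Fin d) (Fin d) ℚ_[p]) × (Fin d → ℚ_[p]) |
      IsFieldTable p x.1 x.2} := by
  have hB := isCompact_closedBall (0 : ℚ_[p]) 1
  have hM : IsCompact {M : Matrix (Fin d) (Fin d) ℚ_[p] | ∀ i j, ‖M i j‖ ≤ 1} := by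
    convert! isCompact_univ_pi fun _ : Fin d ↦ isCompact_univ_pi fun _ : Fin d ↦ hB
    ext
    refine ⟨fun h i _ j _ ↦ mem_closedBall_zero_iff.mpr (h i j),
      fun h i j ↦ mem_closedBall_zero_iff.mp (h i trivial j trivial)⟩
  have hK := (isCompact_univ_pi fun _ : Fin d ↦ hM).prod (isCompact_univ_pi fun _ : Fin d ↦ hB)
  have hm : IsClosed {x : (Fin d → Matrix (Fin d) (Fin d) ℚ_[p]) × (Fin d → ℚ_[p]) |
      ∀ i j, x.1 i * x.1 j = ∑ k, x.1 i k j • x.1 k} := by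
    simp only [Set.ofPred_forall]
    exact isClosed_iInter fun i ↦ isClosed_iInter fun j ↦ isClosed_eq (by fun_prop) (by fun_prop)
  have hc : IsClosed {x : (Fin d → Matrix (Fin d) (Fin d) ℚ_[p]) × (Fin d → ℚ_[p]) |
      ∀ i j, x.1 i * x.1 j = x.1 j * x.1 i} := by
    simp only [Set.ofPred_forall]
    exact isClosed_iInter fun i ↦ isClosed_iInter fun j ↦ isClosed_eq (by fun_prop) (by fun_prop)
  have hu : IsClosed {x : (Fin d → Matrix (Fin d) (Fin d) ℚ_[p]) × (Fin d → ℚ_[p]) |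
      ∑ i, x.2 i • x.1 i = 1} := isClosed_eq (by fun_prop) (by fun_prop)
  have hd : IsClosed {x : (Fin d → Matrix (Fin d) (Fin d) ℚ_[p]) × (Fin d → ℚ_[p]) |
      ∀ (c : Fin d → ℚ_[p]) (i), ‖c i‖ ^ d ≤ (p : ℝ) ^ d * ‖(∑ j, c j • x.1 j).det‖} := by
    simp only [Set.ofPred_forall]
    refine isClosed_iInter fun c ↦ isClosed_iInter fun i ↦ isClosed_le (by fun_prop) ?_
    exact continuous_const.mul (Continuous.matrix_det (by fun_prop)).norm
  convert! (((hK.inter_right hm).inter_right hc).inter_right hu).inter_right hd using 1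
  ext x
  constructor
  · intro h
    exact ⟨⟨⟨⟨⟨fun i _ ↦ h.norm_le i, fun i _ ↦ mem_closedBall_zero_iff.mpr (h.norm_unit_le i)⟩,
      h.mul_eq⟩, h.comm⟩, h.sum_unit⟩, h.le_norm_det⟩
  · rintro ⟨⟨⟨⟨⟨h₁, h₂⟩, h₃⟩, h₄⟩, h₅⟩, h₆⟩
    exact ⟨fun i ↦ h₁ i trivial, fun i ↦ mem_closedBall_zero_iff.mp (h₂ i trivial), h₃, h₄, h₅, h₆⟩

theorem IsFieldTable.exists_irreducible_charpoly {A : Fin d → Matrix (Fin d) (Fin d) ℚ_[p]}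
    {u : Fin d → ℚ_[p]} (h : IsFieldTable p A u) [NeZero d] :
    ∃ c : Fin d → ℚ_[p], Irreducible (∑ i, c i • A i).charpoly := by
  let S := Algebra.adjoin ℚ_[p] (Set.range A)
  have hspan : Subalgebra.toSubmodule S = Submodule.span ℚ_[p] (Set.range A) := by
    refine le_antisymm (fun x hx ↦ ?_) (Algebra.span_le_adjoin _ _)
    have h1 : (1 : Matrix (Fin d) (Fin d) ℚ_[p]) ∈ Submodule.span ℚ_[p] (Set.range A) := by
      rw [← h.sum_unit]
      exact Submodule.sum_mem _ fun i _ ↦ Submodule.smul_mem _ _ (Submodule.subset_span ⟨i, rfl⟩)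
    induction hx using Algebra.adjoin_induction with
    | mem x hx => exact Submodule.subset_span hx
    | algebraMap r => rw [Algebra.algebraMap_eq_smul_one]; exact Submodule.smul_mem _ _ h1
    | add x y _ _ hx hy => exact add_mem hx hy
    | mul x y _ _ hx hy =>
      have := Submodule.mul_mem_mul hx hy
      rw [Submodule.span_mul_span] at this
      refine Submodule.span_le.mpr ?_ this
      rintro _ ⟨_, ⟨i, rfl⟩, _, ⟨j, rfl⟩, rfl⟩
      change A i * A j ∈ _
      rw [h.mul_eq]
      exact Submodule.sum_mem _ fun i _ ↦ Submodule.smul_mem _ _ (Submodule.subset_span ⟨i, rfl⟩)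
  have hcoord (x) (hx : x ∈ S) : ∃ c : Fin d → ℚ_[p], ∑ i, c i • A i = x := by
    rw [← Subalgebra.mem_toSubmodule, hspan] at hx
    exact (Submodule.mem_span_range_iff_exists_fun _).mp hx
  have hdet (c : Fin d → ℚ_[p]) (hc : (∑ i, c i • A i).det = 0) : c = 0 := by
    ext i
    have := h.le_norm_det c i
    rw [hc, norm_zero, mul_zero] at this
    exact norm_eq_zero.mp (pow_eq_zero_iff (NeZero.ne d) |>.mp (this.antisymm (by positivity)))
  have hlin : LinearIndependent ℚ_[p] A := Fintype.linearIndependent_iff.mpr fun c hc ↦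
    congr_fun (hdet c (by rw [hc, Matrix.det_zero]))
  have hS : finrank ℚ_[p] S = d := by
    change finrank ℚ_[p] (Subalgebra.toSubmodule S) = d
    rw [hspan, finrank_span_eq_card hlin, Fintype.card_fin]
  have : IsMulCommutative S := Algebra.isMulCommutative_adjoin ℚ_[p] (by
    rintro _ ⟨i, rfl⟩ _ ⟨j, rfl⟩
    exact h.comm i j)
  obtain ⟨x, hx, hirr⟩ := S.exists_irreducible_charpoly (fun x hx hx0 ↦ by
    obtain ⟨c, rfl⟩ := hcoord x hx
    simp [hdet c hx0]) (by simpa using hS)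
  obtain ⟨c, rfl⟩ := hcoord x hx
  exact ⟨c, hirr⟩

theorem isFieldTable_leftMulMatrix {M : Type*} [Field M] [Algebra ℚ_[p] M]
    [FiniteDimensional ℚ_[p] M] (b : Basis (Fin d) ℚ_[p] M)
    (hmul : ∀ i j k, ‖b.repr (b i * b j) k‖ ≤ 1) (hone : ∀ k, ‖b.repr 1 k‖ ≤ 1)
    (hrepr : ∀ x k, ‖b.repr x k‖ ≤ p * spectralNorm ℚ_[p] M x) :
    IsFieldTable p (fun i ↦ Algebra.leftMulMatrix b (b i)) (b.repr 1) where
  norm_le i j k := by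
    rw [Algebra.leftMulMatrix_eq_repr_mul]
    exact hmul i k j
  norm_unit_le := hone
  mul_eq i j := by
    simp_rw [← map_mul, Algebra.leftMulMatrix_eq_repr_mul, ← map_smul, ← map_sum, b.sum_repr]
  comm i j := by rw [← map_mul, mul_comm, map_mul]
  sum_unit := by simp_rw [← map_smul, ← map_sum, b.sum_repr, map_one]
  le_norm_det c i := by
    simp_rw [← map_smul, ← map_sum]
    rw [← Algebra.norm_eq_matrix_det, norm_algebraNorm_eq_spectralNorm_pow,
      finrank_eq_card_basis b, Fintype.card_fin, ← mul_pow]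
    refine pow_le_pow_left₀ (norm_nonneg _) ?_ d
    have := hrepr (∑ j, c j • b j) i
    rwa [b.repr_sum_self] at this

theorem exists_finiteDimensional_forall_finrank_eq_le (p : ℕ) [Fact p.Prime] (Ω : Type*) [Field Ω]
    [Algebra ℚ_[p] Ω] [IsAlgClosure ℚ_[p] Ω] (d : ℕ) [NeZero d] :
    ∃ L : IntermediateField ℚ_[p] Ω, FiniteDimensional ℚ_[p] L ∧
      ∀ M : IntermediateField ℚ_[p] Ω, finrank ℚ_[p] M = d → M ≤ L := by
  have : Algebra.IsAlgebraic ℚ_[p] Ω := IsAlgClosure.isAlgebraic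
  let T (M : IntermediateField ℚ_[p] Ω) (b : Basis (Fin d) ℚ_[p] M) :
      (Fin d → Matrix (Fin d) (Fin d) ℚ_[p]) × (Fin d → ℚ_[p]) :=
    (fun i ↦ Algebra.leftMulMatrix b (b i), b.repr 1)
  have key : ∃ L : IntermediateField ℚ_[p] Ω, FiniteDimensional ℚ_[p] L ∧
      ∀ M b, T M b ∈ {x : (Fin d → Matrix (Fin d) (Fin d) ℚ_[p]) × (Fin d → ℚ_[p]) |
        IsFieldTable p x.1 x.2} → M ≤ L := by
    refine isCompact_setOf_isFieldTable.induction_on (p := fun s ↦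
      ∃ L : IntermediateField ℚ_[p] Ω, FiniteDimensional ℚ_[p] L ∧ ∀ M b, T M b ∈ s → M ≤ L)
      ⟨⊥, inferInstance, fun _ _ h ↦ h.elim⟩ ?_ ?_ ?_
    · rintro s t hst ⟨L, hL, h⟩
      exact ⟨L, hL, fun M b hM ↦ h M b (hst hM)⟩
    · rintro s t ⟨L₁, hL₁, h₁⟩ ⟨L₂, hL₂, h₂⟩
      exact ⟨L₁ ⊔ L₂, inferInstance, fun M b hM ↦ hM.elim (fun h ↦ (h₁ M b h).trans le_sup_left)
        (fun h ↦ (h₂ M b h).trans le_sup_right)⟩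
    · rintro x hx
      obtain ⟨c, hc⟩ := IsFieldTable.exists_irreducible_charpoly hx
      set f := (∑ i, c i • x.1 i).charpoly with hf
      have hfm : f.Monic := Matrix.charpoly_monic _
      have hfd : f.natDegree = d := by simp [f, Matrix.charpoly_natDegree_eq_dim]
      obtain ⟨ε, hε, H⟩ := exists_adjoin_root_le_of_coeff_near p Ω hfm hc
      let χ (y : (Fin d → Matrix (Fin d) (Fin d) ℚ_[p]) × (Fin d → ℚ_[p])) :=
        (∑ i, c i • y.1 i).charpoly
      have hnear : ∀ᶠ y in nhds x, ∀ i < d + 1, ‖(χ y).coeff i - f.coeff i‖ < ε := by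
        refine (Filter.eventually_all_finite (Set.finite_lt_nat (d + 1))).mpr fun i _ ↦ ?_
        have hcont : Continuous fun y ↦ ‖(χ y).coeff i - f.coeff i‖ :=
          (((Matrix.continuous_charpoly_coeff i).comp (by fun_prop)).sub continuous_const).norm
        refine hcont.continuousAt.eventually_lt continuousAt_const ?_
        simp [χ, f, hε]
      refine ⟨_, mem_nhdsWithin_of_mem_nhds hnear,
        IntermediateField.adjoin ℚ_[p] (f.rootSet Ω), ?_, fun M b hM ↦ ?_⟩
      · have := (f.rootSet_finite Ω).to_subtype
        exact IntermediateField.finiteDimensional_adjoin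
          fun x _ ↦ Algebra.IsIntegral.isIntegral x
      have : FiniteDimensional ℚ_[p] M := b.finiteDimensional_of_finite
      let β : M := ∑ i, c i • b i
      have hχ : χ (T M b) = (Algebra.leftMulMatrix b β).charpoly := by
        simp [χ, T, β, map_sum, map_smul]
      have hχd : (χ (T M b)).natDegree = d := by simp [χ, Matrix.charpoly_natDegree_eq_dim]
      have hβ : aeval (β : Ω) (χ (T M b)) = 0 := by
        have h0 : aeval β (χ (T M b)) = 0 := by
          apply Algebra.leftMulMatrix_injective b
          rw [← aeval_algHom_apply, hχ, Matrix.aeval_self_charpoly, map_zero]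
        simpa [h0] using aeval_algHom_apply M.val β (χ (T M b))
      obtain ⟨h₁, h₂⟩ := H _ (Matrix.charpoly_monic _) (hχd.trans hfd.symm) (fun i ↦ by
        rcases lt_or_ge i (d + 1) with hi | hi
        · exact hM i hi
        · rw [coeff_eq_zero_of_natDegree_lt (hχd.trans_lt hi),
            coeff_eq_zero_of_natDegree_lt (hfd.trans_lt hi)]
          simpa using hε) _ hβ
      have hle : IntermediateField.adjoin ℚ_[p] {(β : Ω)} ≤ M := by simp
      rwa [IntermediateField.eq_of_le_of_finrank_eq hle (by
        rw [h₂, hfd, finrank_eq_card_basis b, Fintype.card_fin])] at h₁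
  obtain ⟨L, hL, H⟩ := key
  refine ⟨L, hL, fun M hM ↦ ?_⟩
  have : FiniteDimensional ℚ_[p] M := .of_finrank_pos (hM ▸ NeZero.pos d)
  obtain ⟨b, hmul, hone, hrepr⟩ := exists_basis_norm_repr_le p M hM
  exact H M b (isFieldTable_leftMulMatrix b hmul hone hrepr)

theorem exists_finiteDimensional_forall_finrank_le_le (p : ℕ) [Fact p.Prime] (Ω : Type*) [Field Ω]
    [Algebra ℚ_[p] Ω] [IsAlgClosure ℚ_[p] Ω] (n : ℕ) :
    ∃ L : IntermediateField ℚ_[p] Ω, FiniteDimensional ℚ_[p] L ∧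
      ∀ M : IntermediateField ℚ_[p] Ω,
        FiniteDimensional ℚ_[p] M → finrank ℚ_[p] M ≤ n → M ≤ L := by
  choose L hL h using fun d : ℕ ↦ exists_finiteDimensional_forall_finrank_eq_le p Ω (d + 1)
  refine ⟨⨆ i : Fin n, L i, inferInstance, fun M _ hn ↦ ?_⟩
  have hpos : 0 < finrank ℚ_[p] M := finrank_pos
  exact (h (finrank ℚ_[p] M - 1) M (by omega)).trans
    (le_iSup (fun i : Fin n ↦ L i) ⟨_, (Nat.sub_one_lt hpos.ne').trans_le hn⟩)

end Padic


/-- Let `K` be a `p`-adic field with a fixed algebraic closure `Kbar`, and let `n` be a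
positive integer. Then there is a finite Galois extension `L` of `K` inside `Kbar` containing
every intermediate field `M` of `Kbar / K` with `[M : K] ≤ n`. -/
theorem exists_galois_extension_containing_all_of_bounded_degree
    (p : ℕ) [Fact p.Prime] (K : Type) [Field K] [Algebra ℚ_[p] K]
    [FiniteDimensional ℚ_[p] K]
    (Kbar : Type) [Field Kbar] [Algebra K Kbar] [IsAlgClosure K Kbar]
    (n : ℕ) (hn : 0 < n) :
    ∃ L : IntermediateField K Kbar, FiniteDimensional K L ∧ IsGalois K L ∧
      ∀ M : IntermediateField K Kbar,
        FiniteDimensional K M → Module.finrank K M ≤ n → M ≤ L := by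
  let : Algebra ℚ_[p] Kbar := ((algebraMap K Kbar).comp (algebraMap ℚ_[p] K)).toAlgebra
  have : IsScalarTower ℚ_[p] K Kbar := .of_algebraMap_eq fun _ ↦ rfl
  have : CharZero K := charZero_of_injective_algebraMap (algebraMap ℚ_[p] K).injective
  have : Algebra.IsAlgebraic K Kbar := IsAlgClosure.isAlgebraic
  have : IsAlgClosure ℚ_[p] Kbar :=
    ⟨IsAlgClosure.isAlgClosed K, Algebra.IsAlgebraic.trans ℚ_[p] K Kbar⟩
  obtain ⟨F, hF, hle⟩ := Padic.exists_finiteDimensional_forall_finrank_le_le p Kbar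
    (Module.finrank ℚ_[p] K * n)
  obtain ⟨L, hfin, hgal, hFL⟩ :=
    IntermediateField.exists_finiteDimensional_of_restrictScalars (K := K) F
  refine ⟨L, hfin, hgal, fun M hM hn x hx ↦ hFL ?_⟩
  have : FiniteDimensional ℚ_[p] (M.restrictScalars ℚ_[p]) :=
    FiniteDimensional.trans ℚ_[p] K M
  refine hle (M.restrictScalars ℚ_[p]) this ?_ hx
  change Module.finrank ℚ_[p] M ≤ _
  rw [← Module.finrank_mul_finrank ℚ_[p] K M]
  exact Nat.mul_le_mul_left _ hn
end

section
/- Let K be a finite extension of ℚ_p and let A be a finite group. Then the set of continuous group homomorphisms from the absolute Galois group Gal(K̄/K) of K (equipped with the Krull topology) to A (equipped with the discrete topology) is finite. -/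
section Families

open Filter Topology Polynomial

variable {ι K E : Type*} [NontriviallyNormedField K] [NormedField E] [NormedAlgebra K E]

/-- The bounded families `(x i)` with `x i` in the intermediate field `L i`. -/
def boundedFamilies (L : ι → IntermediateField K E) : Subalgebra K (ι → E) where
  carrier := {x | (∀ i, x i ∈ L i) ∧ ∃ C, ∀ i, ‖x i‖ ≤ C}
  mul_mem' := by
    rintro x y ⟨hx, C, hC⟩ ⟨hy, D, hD⟩
    refine ⟨fun i => mul_mem (hx i) (hy i), C * D, fun i => ?_⟩
    rw [Pi.mul_apply, norm_mul]
    exact mul_le_mul (hC i) (hD i) (norm_nonneg _) ((norm_nonneg _).trans (hC i))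
  add_mem' := by
    rintro x y ⟨hx, C, hC⟩ ⟨hy, D, hD⟩
    exact ⟨fun i => add_mem (hx i) (hy i), C + D, fun i =>
      (norm_add_le _ _).trans (add_le_add (hC i) (hD i))⟩
  algebraMap_mem' r := ⟨fun i => (L i).algebraMap_mem r, ‖r‖, fun i => by simp⟩

/-- The ideal of the families that tend to zero along a filter. -/
def nullIdeal (L : ι → IntermediateField K E) (l : Filter ι) : Ideal (boundedFamilies L) where
  carrier := {x | Tendsto (x : ι → E) l (𝓝 0)}
  zero_mem' := tendsto_const_nhds
  add_mem' {x y} hx hy := by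
    have h := Tendsto.add (f := (x : ι → E)) (g := (y : ι → E)) hx hy
    rwa [add_zero] at h
  smul_mem' c x hx := by
    obtain ⟨-, C, hC⟩ := c.2
    exact isBoundedUnder_le_mul_tendsto_zero (isBoundedUnder_of ⟨C, hC⟩) hx

theorem mem_nullIdeal {L : ι → IntermediateField K E} {l : Filter ι} {x : boundedFamilies L} :
    x ∈ nullIdeal L l ↔ Tendsto (x : ι → E) l (𝓝 0) := Iff.rfl

/-- A family that is not null along an ultrafilter is eventually bounded away from zero, hence
invertible modulo null families. -/
theorem nullIdeal_isMaximal (L : ι → IntermediateField K E) (l : Ultrafilter ι) :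
    (nullIdeal L l).IsMaximal := by
  classical
  refine Ideal.isMaximal_iff.2 ⟨fun h => ?_, fun J x hJ hx hxJ => ?_⟩
  · rw [mem_nullIdeal] at h
    exact one_ne_zero (tendsto_nhds_unique (tendsto_const_nhds (x := (1 : E))) h)
  · obtain ⟨ε, hε, h⟩ : ∃ ε > 0, ∀ᶠ i in (l : Filter ι), ε ≤ ‖x.1 i‖ := by
      rw [mem_nullIdeal, Metric.tendsto_nhds] at hx
      push Not at hx
      obtain ⟨ε, hε, h⟩ := hx
      exact ⟨ε, hε, by simpa using h⟩
    let y : boundedFamilies L := ⟨fun i => if ε ≤ ‖x.1 i‖ then (x.1 i)⁻¹ else 0, fun i => by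
      dsimp only
      split_ifs
      exacts [inv_mem (x.2.1 i), zero_mem _], ε⁻¹, fun i => by
      dsimp only
      split_ifs with hi
      · rw [norm_inv]
        exact inv_anti₀ hε hi
      · simpa using hε.le⟩
    have hy : 1 - y * x ∈ nullIdeal L l := by
      rw [mem_nullIdeal]
      refine tendsto_const_nhds.congr' (h.mono fun i hi => ?_)
      have : x.1 i ≠ 0 := norm_pos_iff.1 (hε.trans_le hi)
      simp [y, hi, this]
    simpa using J.add_mem (hJ hy) (J.mul_mem_left y hxJ)

/-- More than `n` bounded families in fields of degree at most `n` become linearly dependent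
modulo null families. -/
theorem exists_ne_zero_sum_smul_mem_nullIdeal [ProperSpace K] {n : ℕ}
    {L : ι → IntermediateField K E} [∀ i, FiniteDimensional K (L i)]
    (hL : ∀ i, Module.finrank K (L i) ≤ n) (l : Ultrafilter ι) {J : Type*} [Fintype J]
    (hJ : n < Fintype.card J) (b : J → boundedFamilies L) :
    ∃ a : J → K, a ≠ 0 ∧ ∑ j, a j • b j ∈ nullIdeal L l := by
  have hrel : ∀ i, ∃ c ∈ Metric.sphere (0 : J → K) 1, ∑ j, c j • (b j).1 i = 0 := by
    intro i
    have hdep : ¬ LinearIndependent K fun j => (⟨(b j).1 i, (b j).2.1 i⟩ : L i) := fun h =>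
      absurd (h.fintype_card_le_finrank.trans (hL i)) (not_le.2 hJ)
    obtain ⟨g, hg, k, hk⟩ := Fintype.not_linearIndependent_iff.1 hdep
    have hg' : ∑ j, g j • (b j).1 i = 0 := by
      simpa using congrArg (algebraMap (L i) E) hg
    obtain ⟨m, -, hm⟩ := Finset.exists_max_image Finset.univ (fun j => ‖g j‖) ⟨k, Finset.mem_univ _⟩
    have hm0 : 0 < ‖g m‖ := (norm_pos_iff.2 hk).trans_le (hm k (Finset.mem_univ _))
    refine ⟨(g m)⁻¹ • g, ?_, ?_⟩
    · rw [mem_sphere_zero_iff_norm, norm_smul, norm_inv, le_antisymm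
        ((pi_norm_le_iff_of_nonneg (norm_nonneg _)).2 fun j => hm j (Finset.mem_univ _))
        (norm_le_pi_norm g m), inv_mul_cancel₀ hm0.ne']
    · simp [mul_smul, ← Finset.smul_sum, hg']
  choose c hc hcb using hrel
  obtain ⟨a, ha, hca⟩ := (isCompact_sphere (0 : J → K) 1).ultrafilter_le_nhds (l.map c)
    (tendsto_principal.2 (Eventually.of_forall hc))
  have hca : Tendsto c l (𝓝 a) := hca
  refine ⟨a, ne_zero_of_mem_unit_sphere ⟨a, ha⟩, ?_⟩
  rw [mem_nullIdeal]
  have : ((∑ j, a j • b j : boundedFamilies L) : ι → E) =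
      fun i => ∑ j, (a j - c i j) • (b j).1 i := by
    ext i
    simp [sub_smul, hcb]
  rw [this, ← Finset.sum_const_zero (s := (Finset.univ : Finset J))]
  refine tendsto_finsetSum _ fun j _ => ?_
  obtain ⟨-, C, hC⟩ := (b j).2
  have h1 : Tendsto (fun i => a j - c i j) l (𝓝 0) := by
    simpa using (tendsto_const_nhds (x := a j)).sub ((tendsto_pi_nhds.1 hca) j)
  exact h1.op_zero_isBoundedUnder_le (isBoundedUnder_of ⟨C, hC⟩) (· • ·) fun x y => norm_smul_le x y

/-- Fewer than `n` bounded families in fields of degree `n` do not span all bounded families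
modulo null families. -/
theorem exists_sub_sum_smul_notMem_nullIdeal [CompleteSpace K] {n : ℕ}
    {L : ι → IntermediateField K E} (hL : ∀ i, Module.finrank K (L i) = n) (l : Ultrafilter ι)
    {J : Type*} [Fintype J] (hJ : Fintype.card J < n) (b : J → boundedFamilies L) :
    ∃ e : boundedFamilies L, ∀ g : J → K, e - ∑ j, g j • b j ∉ nullIdeal L l := by
  obtain ⟨c, hc⟩ := NormedField.exists_one_lt_norm K
  have key : ∀ i, ∃ x : L i, ‖x‖ ≤ ‖c‖ + 1 ∧
      ∀ g : J → K, 1 ≤ ‖x - ∑ j, g j • (⟨(b j).1 i, (b j).2.1 i⟩ : L i)‖ := by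
    intro i
    let v : J → L i := fun j => ⟨(b j).1 i, (b j).2.1 i⟩
    let F := Submodule.span K (Set.range v)
    have : FiniteDimensional K F := FiniteDimensional.span_of_finite K (Set.finite_range v)
    have hF : ∃ x, x ∉ F := by
      by_contra! h
      have hle : Module.finrank K F ≤ _ := finrank_range_le_card (R := K) v
      rw [show F = ⊤ from Submodule.eq_top_iff'.2 h, finrank_top, hL] at hle
      lia
    obtain ⟨x, hx, hxF⟩ := riesz_lemma_of_norm_lt hc (lt_add_one ‖c‖)
      (Submodule.closed_of_finiteDimensional F) hF
    exact ⟨x, hx, fun g => hxF _ (Submodule.sum_mem _ fun j _ => F.smul_mem _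
      (Submodule.subset_span ⟨j, rfl⟩))⟩
  choose x hx hxg using key
  refine ⟨⟨fun i => x i, fun i => (x i).2, _, hx⟩, fun g hmem => ?_⟩
  have h0 := tendsto_norm_zero.comp (mem_nullIdeal.1 hmem)
  have h1 := ge_of_tendsto' h0 (b := 1) fun i => by
    refine (hxg i g).trans_eq ?_
    change ‖((x i - ∑ j, g j • (⟨(b j).1 i, (b j).2.1 i⟩ : L i) : L i) : E)‖ = _
    simp
  exact absurd h1 (by norm_num)

/-- The residue field of the bounded families at an ultrafilter. -/
def LimitField (L : ι → IntermediateField K E) (l : Ultrafilter ι) : Type _ :=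
  boundedFamilies L ⧸ nullIdeal L l

namespace LimitField

variable (L : ι → IntermediateField K E) (l : Ultrafilter ι)

/-- The field structure of the quotient by a maximal ideal. It is kept semireducible so that
instance search does not unfold the quotient. -/
noncomputable def quotientField : Field (LimitField L l) :=
  haveI := nullIdeal_isMaximal L l
  Ideal.Quotient.field (nullIdeal L l)

noncomputable instance : Field (LimitField L l) := quotientField L l

/-- The class of a bounded family, as a ring homomorphism. -/
noncomputable def mkRingHom : boundedFamilies L →+* LimitField L l :=
  Ideal.Quotient.mk (nullIdeal L l)

noncomputable instance : Algebra K (LimitField L l) :=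
  ((mkRingHom L l).comp (algebraMap K (boundedFamilies L))).toAlgebra

/-- The class of a bounded family. -/
noncomputable def mk : boundedFamilies L →ₐ[K] LimitField L l where
  __ := mkRingHom L l
  commutes' _ := rfl

theorem mk_surjective : Function.Surjective (mk L l) :=
  Ideal.Quotient.mk_surjective

variable {L l}

theorem mk_eq_zero {x : boundedFamilies L} : mk L l x = 0 ↔ Tendsto (x : ι → E) l (𝓝 0) :=
  Ideal.Quotient.eq_zero_iff_mem (I := nullIdeal L l)

theorem rank_le [ProperSpace K] {n : ℕ} [∀ i, FiniteDimensional K (L i)]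
    (hL : ∀ i, Module.finrank K (L i) ≤ n) : Module.rank K (LimitField L l) ≤ n := by
  refine _root_.rank_le fun s hs => ?_
  by_contra! hn
  choose b hb using fun j : s => mk_surjective L l j
  obtain ⟨a, ha, hab⟩ := exists_ne_zero_sum_smul_mem_nullIdeal hL l (by simpa using hn) b
  refine ha (funext (Fintype.linearIndependent_iff.1 hs a ?_))
  simpa [hb] using mk_eq_zero.2 hab

theorem finrank_eq [ProperSpace K] {n : ℕ} [∀ i, FiniteDimensional K (L i)]
    (hL : ∀ i, Module.finrank K (L i) = n) : Module.finrank K (LimitField L l) = n := by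
  have hrank : Module.rank K (LimitField L l) ≤ n := rank_le fun i => (hL i).le
  have : FiniteDimensional K (LimitField L l) :=
    Module.rank_lt_aleph0_iff.1 (hrank.trans_lt (Cardinal.natCast_lt_aleph0))
  refine (Module.finrank_le_of_rank_le hrank).antisymm ?_
  by_contra! hn
  let B := Module.finBasis K (LimitField L l)
  choose b hb using fun j => mk_surjective L l (B j)
  obtain ⟨e, he⟩ := exists_sub_sum_smul_notMem_nullIdeal hL l (by simpa using hn) b
  refine he (B.repr (mk L l e)) (mk_eq_zero.1 ?_)
  simp [hb, B.sum_repr]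

theorem aeval_mk {x : boundedFamilies L} {P : K[X]} (h : aeval (mk L l x) P = 0) :
    Tendsto (fun i => aeval (x.1 i) P) l (𝓝 0) := by
  rw [aeval_algHom_apply, mk_eq_zero] at h
  convert h using 2 with i
  exact aeval_algHom_apply ((Pi.evalAlgHom K (fun _ : ι => E) i).comp (boundedFamilies L).val) x P

end LimitField

/-- A small value of a monic split polynomial is attained only near a root. -/
theorem exists_mem_rootSet_norm_sub_lt [IsAlgClosed E] {P : K[X]} (hP : P.Monic) {y : E} {δ : ℝ}
    (hδ : 0 < δ) (hy : ‖aeval y P‖ < δ ^ P.natDegree) : ∃ x ∈ P.rootSet E, ‖x - y‖ < δ := by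
  by_contra! h
  have hsplit := IsAlgClosed.splits (P.map (algebraMap K E))
  have hprod : aeval y P = ((P.aroots E).map fun x => y - x).prod := by
    rw [aeval_def, ← eval_map, hsplit.eval_eq_prod_roots]
    simp [hP, aroots_def]
  have hcard : Multiset.card (P.aroots E) = P.natDegree := by
    rw [aroots_def, ← hsplit.natDegree_eq_card_roots, natDegree_map]
  have hle : ∀ s : Multiset E, (∀ x ∈ s, δ ≤ ‖x - y‖) →
      δ ^ Multiset.card s ≤ ‖(s.map fun x => y - x).prod‖ := by
    intro s
    induction s using Multiset.induction_on with
    | empty => simp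
    | cons a s ih =>
      intro hs
      rw [Multiset.map_cons, Multiset.prod_cons, norm_mul, Multiset.card_cons, pow_succ',
        norm_sub_rev]
      exact mul_le_mul (hs a (Multiset.mem_cons_self a s))
        (ih fun x hx => hs x (Multiset.mem_cons_of_mem hx)) (by positivity) (norm_nonneg _)
  have := hle _ fun x hx => h x ((mem_rootSet_of_ne hP.ne_zero).2 ((mem_aroots.1 hx).2))
  rw [hcard, ← hprod] at this
  exact this.not_gt hy

/-- A locally compact ultrametric field of characteristic zero has finitely many extensions of each
degree in an algebraic closure. If `θ` generates the limit field of infinitely many such extensions,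
then by Krasner's lemma infinitely many of them are generated by a root of the minimal polynomial
of `θ`. -/
theorem finite_setOf_finrank_eq [ProperSpace K] [IsUltrametricDist K] [CharZero K]
    [Algebra.IsAlgebraic K E] [IsAlgClosed E] {n : ℕ} (hn : n ≠ 0) :
    {L : IntermediateField K E | Module.finrank K L = n}.Finite := by
  by_contra hinf
  let S := {L : IntermediateField K E | Module.finrank K L = n}
  have : Infinite S := Set.infinite_coe_iff.2 hinf
  let L : S → IntermediateField K E := Subtype.val
  let l : Ultrafilter S := hyperfilter S
  have hL : ∀ i, Module.finrank K (L i) = n := fun i => i.2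
  have hfin : ∀ i, FiniteDimensional K (L i) := fun i =>
    Module.finite_of_finrank_pos (hL i ▸ Nat.pos_of_ne_zero hn)
  have hfr : Module.finrank K (LimitField L l) = n := LimitField.finrank_eq hL
  have : FiniteDimensional K (LimitField L l) :=
    Module.finite_of_finrank_pos (hfr ▸ Nat.pos_of_ne_zero hn)
  obtain ⟨θ, hθ⟩ := Field.exists_primitive_element K (LimitField L l)
  obtain ⟨y, rfl⟩ := LimitField.mk_surjective L l θ
  have hint := Algebra.IsIntegral.isIntegral (R := K) (LimitField.mk L l y)
  let P := minpoly K (LimitField.mk L l y)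
  have hmonic : P.Monic := minpoly.monic hint
  have hirr : Irreducible P := minpoly.irreducible hint
  have hdeg : P.natDegree = n := by
    rw [← hfr, ← IntermediateField.finrank_top', ← hθ, IntermediateField.adjoin.finrank hint]
  have hroots : (P.rootSet E).Finite := P.rootSet_finite E
  obtain ⟨δ, hδ, hsep⟩ : ∃ δ > 0, ∀ x ∈ P.rootSet E, ∀ x' ∈ P.rootSet E,
      x ≠ x' → δ ≤ ‖x - x'‖ := by
    rcases (P.rootSet E).subsingleton_or_nontrivial with hsub | hnon
    · exact ⟨1, one_pos, fun x hx x' hx' hne => absurd (hsub hx hx') hne⟩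
    · refine ⟨_, hroots.infsep_pos_iff_nontrivial.2 hnon, fun x hx x' hx' hne => ?_⟩
      rw [← dist_eq_norm]
      exact Set.infsep_le_dist_of_mem hx hx' hne
  have hev : ∀ᶠ i in (l : Filter S), ‖aeval (y.1 i) P‖ < δ ^ P.natDegree :=
    (LimitField.aeval_mk (minpoly.aeval K _)).norm.eventually_lt_const (by simpa using pow_pos hδ _)
  have hmem : ∀ᶠ i in (l : Filter S),
      L i ∈ (fun x => IntermediateField.adjoin K {x}) '' P.rootSet E := by
    filter_upwards [hev] with i hi
    obtain ⟨x, hx, hxy⟩ := exists_mem_rootSet_norm_sub_lt hmonic hδ hi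
    have hminx : minpoly K x = P :=
      (minpoly.eq_of_irreducible_of_monic hirr ((mem_rootSet.1 hx).2) hmonic).symm
    have hxint := Algebra.IsIntegral.isIntegral (R := K) x
    have hxmem : x ∈ IntermediateField.adjoin K {y.1 i} := by
      refine IsKrasner.krasner (minpoly.irreducible hxint).separable
        (IsAlgClosed.splits _) (Algebra.IsIntegral.isIntegral _) fun x' hx' hne => ?_
      refine hxy.trans_le (hsep x hx x' ?_ hne)
      rwa [isConjRoot_iff_mem_minpoly_rootSet hxint, hminx] at hx'
    refine ⟨x, hx, IntermediateField.eq_of_le_of_finrank_eq ?_ ?_⟩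
    · rw [IntermediateField.adjoin_simple_le_iff]
      exact IntermediateField.adjoin_simple_le_iff.2 (y.2.1 i) hxmem
    · rw [IntermediateField.adjoin.finrank hxint, hminx, hdeg, hL]
  have hfinite : {i | L i ∈ (fun x => IntermediateField.adjoin K {x}) '' P.rootSet E}.Finite :=
    (hroots.image _).preimage Subtype.val_injective.injOn
  exact (Ultrafilter.compl_mem_iff_notMem.1 hfinite.compl_mem_hyperfilter) hmem

end Families

/-- A homomorphism to a finite group with kernel `N` is determined by its values on coset
representatives of `N`. -/
theorem MonoidHom.finite_setOf_ker_eq {G A : Type*} [Group G] [Group A] [Finite A] (N : Subgroup G)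
    [N.FiniteIndex] : {f : G →* A | f.ker = N}.Finite := by
  refine Set.Finite.of_injOn (f := fun f (q : G ⧸ N) => f q.out) (Set.mapsTo_univ _ _) ?_
    Set.finite_univ
  intro f hf g hg hfg
  ext x
  have h : ((x : G ⧸ N).out)⁻¹ * x ∈ N := by
    rw [← QuotientGroup.eq, QuotientGroup.out_eq']
  have hout : ∀ φ : G →* A, φ.ker = N → φ x = φ (x : G ⧸ N).out := fun φ hφ => by
    have hx : ((x : G ⧸ N).out)⁻¹ * x ∈ φ.ker := hφ ▸ h
    rw [MonoidHom.mem_ker, map_mul, map_inv, inv_mul_eq_one] at hx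
    exact hx.symm
  rw [hout f hf, hout g hg]
  exact congrFun hfg x

theorem finite_continuous_monoidHom_of_finite_intermediateField {K E A : Type*} [Field K] [Field E]
    [Algebra K E] [IsGalois K E]
    (hfin : ∀ n ≠ 0, {L : IntermediateField K E | Module.finrank K L = n}.Finite)
    [Group A] [Finite A] [TopologicalSpace A] [DiscreteTopology A] :
    {f : Gal(E/K) →* A | Continuous f}.Finite := by
  let S := ⋃ n ∈ Finset.Icc 1 (Nat.card A), {L : IntermediateField K E | Module.finrank K L = n}
  have hS : S.Finite := (Finset.Icc 1 (Nat.card A)).finite_toSet.biUnion fun n hn => by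
    rw [Finset.coe_Icc, Set.mem_Icc] at hn
    exact hfin n (by lia)
  refine (hS.biUnion (t := fun L => {f : Gal(E/K) →* A | f.ker = L.fixingSubgroup})
    fun L hL => ?_).subset fun f hf => ?_
  · have : L.fixingSubgroup.FiniteIndex := ⟨by
      rw [← IntermediateField.finrank_eq_fixingSubgroup_index]
      simp only [S, Set.mem_iUnion, Finset.mem_Icc, Set.mem_ofPred_eq] at hL
      grind⟩
    exact MonoidHom.finite_setOf_ker_eq _
  · let H : ClosedSubgroup Gal(E/K) := ⟨f.ker, isClosed_singleton.preimage hf⟩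
    have hH : (IntermediateField.fixedField f.ker).fixingSubgroup = f.ker :=
      InfiniteGalois.fixingSubgroup_fixedField H
    refine Set.mem_biUnion (x := IntermediateField.fixedField f.ker) ?_ hH.symm
    simp only [S, Set.mem_iUnion, Finset.mem_Icc, Set.mem_ofPred_eq, exists_prop, exists_eq_right']
    rw [IntermediateField.finrank_eq_fixingSubgroup_index, hH, Subgroup.index_ker]
    exact ⟨Nat.card_pos, Nat.card_mono (Set.toFinite _) (Set.subset_univ _) |>.trans_eq
      Nat.card_univ⟩

/-- Let `K` be a `p`-adic field. Then there are only finitely many continuous group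
homomorphisms from the absolute Galois group `Gal(K̄/K)` (with the Krull topology) to a
finite group `A` (with the discrete topology). -/
theorem finite_continuous_homs_from_absolute_galois_group
    (p : ℕ) [Fact p.Prime] (K : Type) [Field K] [Algebra ℚ_[p] K]
    [FiniteDimensional ℚ_[p] K]
    (A : Type) [Group A] [Finite A] [TopologicalSpace A] [DiscreteTopology A] :
    {f : (AlgebraicClosure K ≃ₐ[K] AlgebraicClosure K) →* A | Continuous f}.Finite := by
  let : NontriviallyNormedField K := spectralNorm.nontriviallyNormedField ℚ_[p] K
  let : NormedAlgebra ℚ_[p] K := spectralNorm.normedAlgebra ℚ_[p] K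
  have : IsUltrametricDist K := IsUltrametricDist.of_normedAlgebra ℚ_[p]
  have : ProperSpace K := FiniteDimensional.proper ℚ_[p] K
  have : CharZero K := charZero_of_injective_algebraMap (algebraMap ℚ_[p] K).injective
  refine finite_continuous_monoidHom_of_finite_intermediateField fun n hn => ?_
  let : NormedField (AlgebraicClosure K) := spectralNorm.normedField K (AlgebraicClosure K)
  let : NormedAlgebra K (AlgebraicClosure K) :=
    spectralNorm.normedAlgebra K (AlgebraicClosure K)
  exact finite_setOf_finrank_eq hn
end
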